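/- Let R be a commutative Noetherian ring of finite Krull dimension d ≥ 1 and let A be a geometric subring of R[T]. Let P be a finitely generated projective A-module whose localization at every prime ideal of A has rank at least d + 1. Then P is cancellative: for every finitely generated A-module Q, if A ⊕ Q ≅ A ⊕ P as A-modules, then Q ≅ P. -/

import Mathlib

open Polynomial

/-- `A` is a geometric subring of `R[T]`, where `d = dim R`: `A` is a Noetherian subring of `R[T]`
containing `R`, there is a non-zero divisor `s ∈ R` with `A_s = R_s[T]` (equivalently, every
polynomial is carried into `A` by a power of `s`), and `dim A = d + 1`. -/
def IsGeometricSubring {R : Type*} [CommRing R] (A : Subalgebra R (Polynomial R)) (d : ℕ) : Prop :=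
  IsNoetherianRing A ∧
  (∃ s : R, s ∈ nonZeroDivisors R ∧ ∀ f : Polynomial R, ∃ k : ℕ, (C s) ^ k * f ∈ A) ∧
  ringKrullDim A = (d + 1 : ℕ)

/-- The rank of the localization `M_p` of a module `M` at a prime `p` (as the finrank of `M_p`
over `R_p`). -/
noncomputable def rankAt {R : Type*} [CommRing R] (M : Type*) [AddCommGroup M] [Module R M]
    (p : Ideal R) (hp : p.IsPrime) : ℕ :=
  letI := hp
  Module.finrank (Localization p.primeCompl) (LocalizedModule p.primeCompl M)

universe v

section

open Module

/-- A finite-dimensional space spanned by `u + 1` vectors, of dimension at most `u`: modifying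
one vector by a non-zero multiple of the last one, the last vector can be discarded. -/
theorem exists_finrank_span_le_of_update {K V : Type*} [Field K] [AddCommGroup V] [Module K V]
    [FiniteDimensional K V] {u : ℕ} (y : Fin u → V) (z : V)
    (h : finrank K (Submodule.span K (Set.range y ∪ {z})) ≤ u) :
    finrank K (Submodule.span K (Set.range y ∪ {z})) ≤ finrank K (Submodule.span K (Set.range y)) ∨
    ∃ j : Fin u, ∀ r : K, r ≠ 0 → finrank K (Submodule.span K (Set.range y ∪ {z})) ≤
      finrank K (Submodule.span K (Set.range (fun i => y i + (if i = j then r else 0) • z))) := by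
  by_cases hz : z ∈ Submodule.span K (Set.range y)
  · left
    apply Submodule.finrank_mono
    rw [Submodule.span_le, Set.union_subset_iff]
    exact ⟨Submodule.subset_span, by simpa using hz⟩
  right
  have hlt : finrank K (Submodule.span K (Set.range y)) < u := by
    refine lt_of_lt_of_le (Submodule.finrank_lt_finrank_of_lt ?_) h
    refine lt_of_le_of_ne (Submodule.span_mono Set.subset_union_left) ?_
    intro he
    apply hz
    rw [he]
    exact Submodule.subset_span (by simp)
  have hdep : ¬ LinearIndependent K y := by
    intro hi
    rw [linearIndependent_iff_card_eq_finrank_span] at hi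
    simp [Set.finrank] at hi
    omega
  rw [Fintype.not_linearIndependent_iff] at hdep
  obtain ⟨c, hc, j, hj⟩ := hdep
  refine ⟨j, fun r hr => ?_⟩
  apply Submodule.finrank_mono
  set y' : Fin u → V := fun i => y i + (if i = j then r else 0) • z with hy'
  have hz' : z ∈ Submodule.span K (Set.range y') := by
    have h1 : ∑ i, c i • y' i = (c j * r) • z := by
      simp [hy', smul_add, Finset.sum_add_distrib, hc, mul_smul]
    have h2 : z = (c j * r)⁻¹ • ∑ i, c i • y' i := by
      rw [h1, smul_smul, inv_mul_cancel₀ (mul_ne_zero hj hr), one_smul]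
    rw [h2]
    exact Submodule.smul_mem _ _ (Submodule.sum_mem _ fun i _ =>
      Submodule.smul_mem _ _ (Submodule.subset_span ⟨i, rfl⟩))
  rw [Submodule.span_le, Set.union_subset_iff]
  refine ⟨?_, by simpa using hz'⟩
  rintro _ ⟨i, rfl⟩
  have : y i = y' i - (if i = j then r else 0) • z := by simp [hy']
  rw [this]
  exact Submodule.sub_mem _ (Submodule.subset_span ⟨i, rfl⟩) (Submodule.smul_mem _ _ hz')

theorem finrank_span_union_singleton_le {K V : Type*} [Field K] [AddCommGroup V] [Module K V]
    [FiniteDimensional K V] (s : Set V) (z : V) :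
    finrank K (Submodule.span K (s ∪ {z})) ≤ finrank K (Submodule.span K s) + 1 := by
  rw [Submodule.span_union]
  refine (Submodule.finrank_add_le_finrank_add_finrank _ _).trans ?_
  gcongr
  exact (finrank_span_le_card ({z} : Set V)).trans (by simp)

theorem exists_linearIndependent_col {K : Type*} [Field K] {ι m : Type*} [Fintype ι] [Fintype m]
    (M : Matrix ι m K) (k : ℕ) (h : k ≤ M.rank) :
    ∃ f : Fin k → m, LinearIndependent K (M.submatrix id f).col := by
  rw [Matrix.rank_eq_finrank_span_cols] at h
  obtain ⟨κ, a, ha, h1, h2⟩ := exists_linearIndependent' K M.col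
  have : Fintype κ := Fintype.ofInjective a ha
  rw [linearIndependent_iff_card_eq_finrank_span, Set.finrank, h1] at h2
  obtain ⟨e⟩ : Nonempty (Fin k ↪ κ) := by
    apply Function.Embedding.nonempty_of_card_le
    simpa [h2] using h
  refine ⟨a ∘ e, ?_⟩
  have h3 : LinearIndependent K (M.col ∘ a) := by
    rw [linearIndependent_iff_card_eq_finrank_span, Set.finrank, h1, h2]
  exact h3.comp e e.injective

/-- A family of vectors of rank at least `k` has a non-vanishing minor of size `k`. -/
theorem exists_det_submatrix_ne_zero {K : Type*} [Field K] {ι m : Type*} [Fintype ι] [Fintype m]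
    (M : Matrix ι m K) (k : ℕ)
    (h : k ≤ finrank K (Submodule.span K (Set.range M))) :
    ∃ (f : Fin k → ι) (g : Fin k → m), (M.submatrix f g).det ≠ 0 := by
  have h' : k ≤ M.transpose.rank := by
    rw [Matrix.rank_eq_finrank_span_cols]; exact h
  obtain ⟨f, hf⟩ := exists_linearIndependent_col M.transpose k h'
  have hr : (M.submatrix f id).rank = k := by
    have := hf.rank_matrix (M := M.submatrix f id)
    simpa using this
  obtain ⟨g, hg⟩ := exists_linearIndependent_col (M.submatrix f id) k hr.ge
  refine ⟨f, g, ?_⟩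
  have := Matrix.linearIndependent_cols_iff_isUnit.mp hg
  rw [Matrix.isUnit_iff_isUnit_det] at this
  exact this.ne_zero

/-- The image of a vector in the fibre of `A ^ m` over the prime `p`. -/
noncomputable def fiberVec {A : Type*} [CommRing A] {m : Type*} (p : PrimeSpectrum A)
    (v : m → A) : m → p.asIdeal.ResidueField :=
  fun j => algebraMap A p.asIdeal.ResidueField (v j)

theorem fiberVec_eq_iff {A : Type*} [CommRing A] {m : Type*} (p : PrimeSpectrum A)
    (v w : m → A) : fiberVec p v = fiberVec p w ↔ ∀ j, v j - w j ∈ p.asIdeal := by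
  simp only [funext_iff, fiberVec, ← Ideal.algebraMap_residueField_eq_zero, map_sub, sub_eq_zero]

theorem fiberVec_add_mul {A : Type*} [CommRing A] {m : Type*} (p : PrimeSpectrum A)
    (v w : m → A) (b : A) : fiberVec p (fun j => v j + b * w j) =
      fiberVec p v + algebraMap A p.asIdeal.ResidueField b • fiberVec p w := by
  ext j
  simp only [fiberVec, map_add, map_mul, Pi.add_apply, Pi.smul_apply, smul_eq_mul]

/-- The rank of a family of vectors `x i ∈ A ^ m` in the fibre over the prime `p`. -/
noncomputable def fiberRank {A : Type*} [CommRing A] {ι m : Type*} (p : PrimeSpectrum A)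
    (x : ι → m → A) : ℕ :=
  finrank p.asIdeal.ResidueField (Submodule.span p.asIdeal.ResidueField
    (Set.range fun i => fiberVec p (x i)))

theorem fiberRank_congr {A : Type*} [CommRing A] {ι m : Type*} (p : PrimeSpectrum A)
    (x y : ι → m → A) (h : ∀ i j, x i j - y i j ∈ p.asIdeal) : fiberRank p x = fiberRank p y := by
  have : (fun i => fiberVec p (x i)) = fun i => fiberVec p (y i) :=
    funext fun i => (fiberVec_eq_iff p _ _).mpr (h i)
  rw [fiberRank, fiberRank, this]

theorem exists_ideal_le_iff_fiberRank_le {A : Type*} [CommRing A] {ι m : Type*} [Fintype ι]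
    [Fintype m] (x : ι → m → A) (k : ℕ) :
    ∃ I : Ideal A, ∀ p : PrimeSpectrum A, I ≤ p.asIdeal ↔ fiberRank p x ≤ k := by
  refine ⟨Ideal.span {r | ∃ (f : Fin (k + 1) → ι) (g : Fin (k + 1) → m),
    r = ((Matrix.of x).submatrix f g).det}, fun p => ?_⟩
  set κ := p.asIdeal.ResidueField
  set M : Matrix ι m κ := (Matrix.of x).map (algebraMap A κ) with hM
  have hdet : ∀ (f : Fin (k + 1) → ι) (g : Fin (k + 1) → m),
      ((Matrix.of x).submatrix f g).det ∈ p.asIdeal ↔ (M.submatrix f g).det = 0 := by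
    intro f g
    rw [← Ideal.algebraMap_residueField_eq_zero, RingHom.map_det]
    rfl
  have hw : fiberRank p x = finrank κ (Submodule.span κ (Set.range M)) := rfl
  rw [Ideal.span_le, hw]
  constructor
  · intro h
    by_contra hc
    obtain ⟨f, g, hfg⟩ := exists_det_submatrix_ne_zero M (k + 1) (by omega)
    exact hfg ((hdet f g).mp (h ⟨f, g, rfl⟩))
  · rintro h _ ⟨f, g, rfl⟩
    refine (hdet f g).mpr ?_
    by_contra hne
    have h1 : LinearIndependent κ (M.submatrix f g).row := by
      rw [Matrix.linearIndependent_rows_iff_isUnit, Matrix.isUnit_iff_isUnit_det]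
      exact IsUnit.mk0 _ hne
    have h2 : LinearIndependent κ (fun i => M (f i)) := by
      refine LinearIndependent.of_comp (LinearMap.funLeft κ κ g) ?_
      exact h1
    rw [linearIndependent_iff_card_eq_finrank_span] at h2
    have h3 : finrank κ (Submodule.span κ (Set.range fun i => M (f i))) ≤
        finrank κ (Submodule.span κ (Set.range M)) := by
      apply Submodule.finrank_mono
      apply Submodule.span_mono
      rintro _ ⟨i, rfl⟩
      exact ⟨f i, rfl⟩
    simp [Set.finrank] at h2
    omega

theorem range_fin_succ_last {α : Type*} {u : ℕ} (x : Fin (u + 1) → α) :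
    Set.range x = Set.range (fun i : Fin u => x i.castSucc) ∪ {x (Fin.last u)} := by
  ext v
  constructor
  · rintro ⟨i, rfl⟩
    induction i using Fin.lastCases with
    | last => right; rfl
    | cast i => left; exact ⟨i, rfl⟩
  · rintro (⟨i, rfl⟩ | rfl)
    exacts [⟨_, rfl⟩, ⟨_, rfl⟩]

/-- The span of the vectors `y i + c i • z` together with `z`. -/
theorem span_range_add_smul_union {K V : Type*} [Field K] [AddCommGroup V] [Module K V]
    {ι : Type*} (y : ι → V) (c : ι → K) (z : V) :
    Submodule.span K (Set.range (fun i => y i + c i • z) ∪ {z}) =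
      Submodule.span K (Set.range y ∪ {z}) := by
  apply le_antisymm <;> rw [Submodule.span_le, Set.union_subset_iff]
  · refine ⟨?_, fun v hv => Submodule.subset_span (Or.inr hv)⟩
    rintro _ ⟨i, rfl⟩
    exact add_mem (Submodule.subset_span (Or.inl ⟨i, rfl⟩))
      (Submodule.smul_mem _ _ (Submodule.subset_span (Or.inr rfl)))
  · refine ⟨?_, fun v hv => Submodule.subset_span (Or.inr hv)⟩
    rintro _ ⟨i, rfl⟩
    have : y i = (y i + c i • z) - c i • z := by simp
    rw [this]
    exact sub_mem (Submodule.subset_span (Or.inl ⟨i, rfl⟩))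
      (Submodule.smul_mem _ _ (Submodule.subset_span (Or.inr rfl)))

theorem fiberRank_le_add_one {A : Type*} [CommRing A] {m : Type*} [Fintype m] {u : ℕ}
    (p : PrimeSpectrum A) (x : Fin (u + 1) → m → A) (b : Fin u → A) :
    fiberRank p x ≤
      fiberRank p (fun (i : Fin u) j => x i.castSucc j + b i * x (Fin.last u) j) + 1 := by
  unfold fiberRank
  rw [range_fin_succ_last, ← span_range_add_smul_union _ (fun i => algebraMap A _ (b i)),
    funext fun i => fiberVec_add_mul p (x (Fin.castSucc i)) (x (Fin.last u)) (b i)]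
  exact finrank_span_union_singleton_le (K := p.asIdeal.ResidueField) _ _

theorem exists_fiberRank_le_of_finset {A : Type*} [CommRing A] {m : Type*} [Fintype m] {u : ℕ}
    (a : A) (x : Fin (u + 1) → m → A) (F : Finset (PrimeSpectrum A))
    (ha : ∀ p ∈ F, a ∉ p.asIdeal) (hF : ∀ p ∈ F, fiberRank p x ≤ u) :
    ∃ b : Fin u → A, ∀ p ∈ F, fiberRank p x ≤
      fiberRank p (fun (i : Fin u) j => x i.castSucc j + (a * b i) * x (Fin.last u) j) := by
  classical
  induction hn : F.card generalizing F with
  | zero =>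
    rw [Finset.card_eq_zero] at hn
    subst hn
    exact ⟨0, by simp⟩
  | succ k ih =>
    obtain ⟨p, hp⟩ := F.exists_minimal (Finset.card_pos.mp (by omega))
    obtain ⟨b, hb⟩ := ih (F.erase p) (fun q hq => ha q (Finset.mem_of_mem_erase hq))
      (fun q hq => hF q (Finset.mem_of_mem_erase hq)) (by rw [Finset.card_erase_of_mem hp.1]; omega)
    obtain ⟨r, hr, hrp⟩ : ∃ r : A, (∀ q ∈ F.erase p, r ∈ q.asIdeal) ∧ r ∉ p.asIdeal := by
      have : ¬ ((F.erase p).inf fun q => q.asIdeal) ≤ p.asIdeal := by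
        intro h
        obtain ⟨q, hq, hqp⟩ := (Ideal.IsPrime.inf_le' p.2).mp h
        have h1 : p ≤ q := hp.2 (Finset.mem_of_mem_erase hq) hqp
        exact Finset.ne_of_mem_erase hq (le_antisymm hqp h1)
      obtain ⟨r, h1, h2⟩ := Set.not_subset.mp this
      refine ⟨r, fun q hq => ?_, h2⟩
      exact (Finset.inf_le hq : _ ≤ q.asIdeal) h1
    have hw : fiberRank p x = finrank p.asIdeal.ResidueField
        (Submodule.span p.asIdeal.ResidueField (Set.range (fun i : Fin u =>
          fiberVec p (fun j => x i.castSucc j + (a * b i) * x (Fin.last u) j)) ∪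
          {fiberVec p (x (Fin.last u))})) := by
      unfold fiberRank
      rw [range_fin_succ_last, ← span_range_add_smul_union _ (fun i => algebraMap A _ (a * b i)),
        funext fun i => fiberVec_add_mul p (x (Fin.castSucc i)) (x (Fin.last u)) (a * b i)]
    rcases exists_finrank_span_le_of_update _ _ (hw ▸ hF p hp.1) with h | ⟨j₀, h⟩
    · refine ⟨b, fun q hq => ?_⟩
      rcases eq_or_ne q p with rfl | hne
      · rw [hw]; exact h
      · exact hb q (Finset.mem_erase.mpr ⟨hne, hq⟩)
    · refine ⟨fun i => b i + if i = j₀ then r else 0, fun q hq => ?_⟩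
      rcases eq_or_ne q p with rfl | hne
      · rw [hw]
        refine (h (algebraMap A _ (a * r)) ?_).trans_eq ?_
        · rw [Ne, Ideal.algebraMap_residueField_eq_zero]
          exact fun hc => (q.2.mem_or_mem hc).elim (ha q hq) hrp
        · have h3 : (fun i : Fin u => fiberVec q (fun j => x i.castSucc j +
              (a * (b i + if i = j₀ then r else 0)) * x (Fin.last u) j)) = fun i =>
              fiberVec q (fun j => x i.castSucc j + (a * b i) * x (Fin.last u) j) +
              (if i = j₀ then algebraMap A q.asIdeal.ResidueField (a * r) else 0) •
                fiberVec q (x (Fin.last u)) := by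
            funext i
            rw [fiberVec_add_mul, fiberVec_add_mul, add_assoc, ← add_smul]
            congr 2
            split_ifs <;> simp [mul_add]
          rw [fiberRank, h3]
      · have hq' := Finset.mem_erase.mpr ⟨hne, hq⟩
        refine (hb q hq').trans_eq (fiberRank_congr q _ _ fun i j => ?_)
        have h1 : (if i = j₀ then r else 0) ∈ q.asIdeal := by
          split_ifs
          · exact hr q hq'
          · exact zero_mem _
        have h2 : (x i.castSucc j + a * b i * x (Fin.last u) j) - (x i.castSucc j +
          a * (b i + if i = j₀ then r else 0) * x (Fin.last u) j) =
          - (a * x (Fin.last u) j) * (if i = j₀ then r else 0) := by ring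
        rw [h2]
        exact Ideal.mul_mem_left _ _ h1

/-- A form of the Eisenbud-Evans theorem on basic elements: `h` plays the role of a dimension
function on the locally closed set of primes containing `I` but not `a`. -/
theorem exists_basic_element {A : Type*} [CommRing A] [IsNoetherianRing A] {m : Type*} [Fintype m]
    (I : Ideal A) (a : A) (h : PrimeSpectrum A → ℕ)
    (hmono : ∀ q p : PrimeSpectrum A, I ≤ q.asIdeal → a ∉ p.asIdeal → q < p → h q < h p) (n : ℕ)
    {u : ℕ} (x : Fin (u + 1) → m → A)
    (hx : ∀ p : PrimeSpectrum A, I ≤ p.asIdeal → a ∉ p.asIdeal →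
      u + 1 ≤ fiberRank p x ∨ n ≤ fiberRank p x + h p) :
    ∃ c : Fin u → A, ∀ p : PrimeSpectrum A, I ≤ p.asIdeal → a ∉ p.asIdeal → h p < n →
      ∃ j, x 0 j + a * ∑ i, c i * x i.succ j ∉ p.asIdeal := by
  induction u with
  | zero =>
    refine ⟨0, fun p hI hap hn => ?_⟩
    by_contra! hc
    have h0 : fiberRank p x = 0 := by
      have : fiberRank p x = fiberRank p (fun (_ : Fin 1) (_ : m) => (0 : A)) := by
        refine fiberRank_congr p _ _ fun i j => ?_
        rw [Fin.fin_one_eq_zero i]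
        simpa using hc j
      rw [this]
      unfold fiberRank
      have h2 : Submodule.span p.asIdeal.ResidueField (Set.range fun (_ : Fin 1) =>
          fiberVec p (fun _ : m => (0 : A))) = ⊥ := by
        rw [Submodule.span_eq_bot]
        rintro _ ⟨i, rfl⟩
        ext; simp [fiberVec]
      rw [h2, finrank_bot]
    rcases hx p hI hap with h1 | h1 <;> omega
  | succ u ih =>
    choose J hJ using exists_ideal_le_iff_fiberRank_le x
    have hfin : {p : PrimeSpectrum A | I ≤ p.asIdeal ∧ a ∉ p.asIdeal ∧ fiberRank p x ≤ u + 1 ∧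
        fiberRank p x + h p = n}.Finite := by
      have h1 : (⋃ e ∈ Finset.range (u + 2), (I ⊔ J e).minimalPrimes).Finite :=
        Set.Finite.biUnion (Finset.finite_toSet _) fun e _ =>
          Ideal.finite_minimalPrimes_of_isNoetherianRing _ _
      refine Set.Finite.of_finite_image (f := PrimeSpectrum.asIdeal) (h1.subset ?_)
        (fun p _ q _ hpq => PrimeSpectrum.ext hpq)
      rintro _ ⟨p, ⟨hI, hap, hu, hn⟩, rfl⟩
      rw [Set.mem_iUnion₂]
      refine ⟨fiberRank p x, by simp; omega, ⟨p.2, sup_le hI ((hJ _ p).mpr le_rfl)⟩, ?_⟩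
      rintro q ⟨hq, hq2⟩ hqp
      by_contra hpq
      have hlt : (⟨q, hq⟩ : PrimeSpectrum A) < p := lt_of_le_not_ge hqp hpq
      have h2 := hmono ⟨q, hq⟩ p (le_sup_left.trans hq2) hap hlt
      have h3 := (hJ _ ⟨q, hq⟩).mp (le_sup_right.trans hq2)
      rcases hx ⟨q, hq⟩ (le_sup_left.trans hq2) (fun hc => hap (hqp hc)) with h4 | h4 <;> omega
    obtain ⟨b, hb⟩ := exists_fiberRank_le_of_finset a x hfin.toFinset
      (by simp only [Set.Finite.mem_toFinset, Set.mem_ofPred_eq]; tauto)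
      (by simp only [Set.Finite.mem_toFinset, Set.mem_ofPred_eq]; tauto)
    obtain ⟨c, hc⟩ := ih
      (fun (i : Fin (u + 1)) j => x i.castSucc j + (a * b i) * x (Fin.last _) j) (by
      intro p hI hap
      have h1 := fiberRank_le_add_one p x (fun i => a * b i)
      by_cases hbad : fiberRank p x ≤ u + 1 ∧ fiberRank p x + h p = n
      · have := hb p (by simp only [Set.Finite.mem_toFinset, Set.mem_ofPred_eq]; tauto)
        right; omega
      · rcases hx p hI hap with h2 | h2 <;> omega)
    refine ⟨Fin.snoc c (b 0 + a * ∑ i, c i * b i.succ), fun p hI hap hn => ?_⟩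
    obtain ⟨j, hj⟩ := hc p hI hap hn
    refine ⟨j, fun hmem => hj ?_⟩
    convert hmem using 1
    rw [Fin.sum_univ_castSucc]
    simp only [Fin.snoc_castSucc, Fin.snoc_last, mul_add, Finset.sum_add_distrib, Fin.castSucc_zero,
      Fin.succ_last, Fin.succ_castSucc, Finset.mul_sum, add_mul, Finset.sum_mul]
    have : ∀ i, a * (a * (c i * b i.succ) * x (Fin.last (u+1)) j) =
        a * (c i * (a * b i.succ * x (Fin.last (u+1)) j)) := by
      intro i; ring
    simp only [Nat.succ_eq_add_one, this]
    ring

theorem fiberRank_mono {A : Type*} [CommRing A] {ι ι' m : Type*} [Finite ι] (p : PrimeSpectrum A)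
    (x : ι → m → A) (f : ι' → ι) : fiberRank p (fun i => x (f i)) ≤ fiberRank p x := by
  have := FiniteDimensional.span_of_finite p.asIdeal.ResidueField
    (Set.finite_range fun i => fiberVec p (x i))
  refine Submodule.finrank_mono (Submodule.span_mono ?_)
  rintro _ ⟨i, rfl⟩
  exact ⟨f i, rfl⟩

/-- The rank of a projective module at `p` is at most the rank over `κ(p)` of any projector
defining it. -/
theorem rankAtStalk_le_fiberRank {A : Type*} [CommRing A] {P : Type*} [AddCommGroup P] [Module A P]
    [Module.Finite A P] [Module.Projective A P] {m : ℕ} (ρ : (Fin m → A) →ₗ[A] P)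
    (i : P →ₗ[A] (Fin m → A)) (h : ρ ∘ₗ i = LinearMap.id) (p : PrimeSpectrum A) :
    rankAtStalk P p ≤ fiberRank p (fun k => i (ρ (Pi.single k 1))) := by
  rw [rankAtStalk_eq]
  set κ := p.asIdeal.ResidueField
  let L : TensorProduct A κ P →ₗ[κ] (Fin m → κ) :=
    (TensorProduct.piScalarRight A κ κ (Fin m)).toLinearMap ∘ₗ i.baseChange κ
  have hL : Function.Injective L := by
    refine (TensorProduct.piScalarRight A κ κ (Fin m)).injective.comp ?_
    refine Function.LeftInverse.injective (g := ρ.baseChange κ) fun z => ?_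
    rw [← LinearMap.comp_apply, ← LinearMap.baseChange_comp, h, LinearMap.baseChange_id]
    rfl
  have hr : finrank κ (TensorProduct A κ P) = finrank κ (LinearMap.range L) :=
    (LinearEquiv.ofInjective L hL).finrank_eq
  change finrank κ (TensorProduct A κ P) ≤ _
  rw [hr]
  refine Submodule.finrank_mono ?_
  have hLt : ∀ w : P, L (1 ⊗ₜ w) = fiberVec p (i w) := by
    intro w
    ext j
    simp [L, fiberVec, Algebra.smul_def]
    rfl
  rintro _ ⟨z, rfl⟩
  induction z with
  | zero => simp
  | add x y hx hy => rw [map_add]; exact add_mem hx hy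
  | tmul x y =>
    have h1 : x ⊗ₜ[A] y = x • ((1 : κ) ⊗ₜ[A] y) := by
      rw [TensorProduct.smul_tmul', smul_eq_mul, mul_one]
    rw [h1, map_smul]
    refine Submodule.smul_mem _ _ ?_
    have h2 : y = ∑ k, (i y k) • ρ (Pi.single k 1) := by
      conv_lhs => rw [← LinearMap.id_apply (R := A) y, ← h, LinearMap.comp_apply,
        pi_eq_sum_univ' (i y), map_sum]
      refine Finset.sum_congr rfl fun k _ => ?_
      rw [map_smul]
    rw [h2, TensorProduct.tmul_sum, map_sum]
    refine Submodule.sum_mem _ fun k _ => ?_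
    rw [TensorProduct.tmul_smul, ← algebraMap_smul κ (i y k), map_smul, hLt]
    exact Submodule.smul_mem _ _ (Submodule.subset_span ⟨k, rfl⟩)

/-- The module form of the theorem on basic elements. -/
theorem exists_dual_apply_notMem {A : Type*} [CommRing A] [IsNoetherianRing A] {P : Type*}
    [AddCommGroup P] [Module A P] [Module.Finite A P] [Module.Projective A P] (n : ℕ)
    (hrank : ∀ p : PrimeSpectrum A, n ≤ rankAtStalk P p) (I : Ideal A) (c : A)
    (h : PrimeSpectrum A → ℕ)
    (hmono : ∀ q p : PrimeSpectrum A, I ≤ q.asIdeal → c ∉ p.asIdeal → q < p → h q < h p)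
    (a μ : A) (w : P) (φ : Dual A P) (huni : μ * a + φ w = 1) :
    ∃ q : P, ∀ p : PrimeSpectrum A, I ≤ p.asIdeal → c ∉ p.asIdeal → h p < n →
      ∃ ψ : Dual A P, ψ (w + (a * c) • q) ∉ p.asIdeal := by
  obtain ⟨m, ρ, hρ⟩ := Module.Finite.exists_fin' A P
  obtain ⟨i, hi⟩ := Module.projective_lifting_property ρ LinearMap.id hρ
  obtain ⟨b, hb⟩ := exists_basic_element I (a * c) h
    (fun q p hq hp => hmono q p hq fun hc => hp (Ideal.mul_mem_left _ _ hc)) n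
    (Fin.cons (i w) (fun k => i (ρ (Pi.single k 1))) : Fin (m + 1) → Fin m → A)
    (fun p _ _ => Or.inr <| le_trans ((hrank p).trans ((rankAtStalk_le_fiberRank ρ i hi p).trans
      (fiberRank_mono p (Fin.cons (i w) (fun k => i (ρ (Pi.single k 1))) : Fin (m + 1) → Fin m → A)
        Fin.succ))) (Nat.le_add_right _ _))
  refine ⟨∑ k, b k • ρ (Pi.single k 1), fun p hI hc hn => ?_⟩
  by_cases hac : a * c ∈ p.asIdeal
  · have ha : a ∈ p.asIdeal := (p.2.mem_or_mem hac).resolve_right hc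
    refine ⟨φ, fun hmem => p.2.ne_top ((Ideal.eq_top_iff_one _).mpr ?_)⟩
    rw [map_add, map_smul, smul_eq_mul] at hmem
    rw [← huni]
    exact add_mem (Ideal.mul_mem_left _ _ ha)
      ((Submodule.add_mem_iff_left _ (Ideal.mul_mem_right _ _ hac)).mp hmem)
  · obtain ⟨j, hj⟩ := hb p hI hac hn
    refine ⟨LinearMap.proj j ∘ₗ i, fun hmem => hj ?_⟩
    convert hmem using 1
    simp

section Height

variable {R : Type*} [CommRing R] {A : Subalgebra R R[X]} {s₀ : R}

/-- If `A[1/s₀] = R[1/s₀][X]`, then the localization of `A` at a prime of `R` not containing `s₀`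
is a polynomial ring. -/
theorem isLocalization_polynomial_localization (hA : ∀ f : R[X], ∃ k : ℕ, (C s₀) ^ k * f ∈ A)
    (q : Ideal R) [q.IsPrime] (hq : s₀ ∉ q) :
    letI := (((mapRingHom (algebraMap R (Localization.AtPrime q))).comp
      A.val.toRingHom).toAlgebra : Algebra A (Localization.AtPrime q)[X])
    IsLocalization (q.primeCompl.map (algebraMap R A)) (Localization.AtPrime q)[X] := by
  let := (((mapRingHom (algebraMap R (Localization.AtPrime q))).comp
      A.val.toRingHom).toAlgebra : Algebra A (Localization.AtPrime q)[X])
  have hmap : ∀ a : A, algebraMap A (Localization.AtPrime q)[X] a =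
    (a : R[X]).map (algebraMap R (Localization.AtPrime q)) := fun _ => rfl
  have hC : ∀ r : R, ((algebraMap R A r : A) : R[X]) = C r := fun _ => rfl
  refine (isLocalization_iff _ _).mpr ⟨?_, ?_, ?_⟩
  · rintro ⟨_, r, hr, rfl⟩
    rw [hmap, hC, map_C, isUnit_C]
    exact IsLocalization.map_units _ (⟨r, hr⟩ : q.primeCompl)
  · intro z
    obtain ⟨b, hb, hbz⟩ := IsLocalization.integerNormalization_spec q.primeCompl z
    obtain ⟨k, hk⟩ := hA (IsLocalization.integerNormalization q.primeCompl z)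
    refine ⟨⟨⟨_, hk⟩, ⟨algebraMap R A (s₀ ^ k * b), _,
      mul_mem (pow_mem (show s₀ ∈ q.primeCompl from hq) k) hb, rfl⟩⟩, ?_⟩
    rw [hmap, hmap, hC, map_C]
    simp only [Polynomial.map_mul, Polynomial.map_pow, map_C, hbz, map_mul, map_pow,
      Algebra.smul_def]
    rw [IsScalarTower.algebraMap_apply R (Localization.AtPrime q) (Localization.AtPrime q)[X],
      algebraMap_eq]
    ring
  · intro x y hxy
    rw [hmap, hmap] at hxy
    have h1 : ∀ n, ∃ c : q.primeCompl, (c : R) * (x : R[X]).coeff n = c * (y : R[X]).coeff n := by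
      intro n
      apply IsLocalization.exists_of_eq (S := Localization.AtPrime q)
      have := congrArg (fun f => f.coeff n) hxy
      simpa using this
    choose c hc using h1
    set N := max (x : R[X]).natDegree (y : R[X]).natDegree
    refine ⟨⟨algebraMap R A (∏ n ∈ Finset.range (N + 1), (c n : R)), _,
      Submonoid.prod_mem _ fun n _ => (c n).2, rfl⟩, ?_⟩
    apply Subtype.ext
    simp only [Subalgebra.coe_mul, hC]
    ext n
    rw [coeff_C_mul, coeff_C_mul]
    by_cases hn : n < N + 1
    · rw [← Finset.mul_prod_erase _ _ (Finset.mem_range.mpr hn), mul_right_comm, hc,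
        mul_right_comm]
    · rw [coeff_eq_zero_of_natDegree_lt (show (x : R[X]).natDegree < n by omega),
        coeff_eq_zero_of_natDegree_lt (show (y : R[X]).natDegree < n by omega)]

theorem height_le_height_comap_add_one [IsNoetherianRing R]
    (hA : ∀ f : R[X], ∃ k : ℕ, (C s₀) ^ k * f ∈ A) (M : Ideal A) [M.IsPrime]
    (hM : algebraMap R A s₀ ∉ M) : M.height ≤ (M.comap (algebraMap R A)).height + 1 := by
  set q := M.comap (algebraMap R A) with hq
  have : q.IsPrime := Ideal.comap_isPrime _ _
  let := (((mapRingHom (algebraMap R (Localization.AtPrime q))).comp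
      A.val.toRingHom).toAlgebra : Algebra A (Localization.AtPrime q)[X])
  have := isLocalization_polynomial_localization hA q hM
  have hdis : Disjoint ((q.primeCompl.map (algebraMap R A) : Submonoid A) : Set A) (M : Set A) := by
    rw [Set.disjoint_left]
    rintro _ ⟨r, hr, rfl⟩ h
    exact hr h
  rw [← IsLocalization.height_map_of_disjoint (S := (Localization.AtPrime q)[X])
    (q.primeCompl.map (algebraMap R A)) M hdis]
  have hp := IsLocalization.isPrime_of_isPrime_disjoint (q.primeCompl.map (algebraMap R A))
    (Localization.AtPrime q)[X] M inferInstance hdis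
  have h1 := Ideal.height_le_ringKrullDim_of_ne_top hp.ne_top
  rw [Polynomial.ringKrullDim_of_isNoetherianRing,
    IsLocalization.AtPrime.ringKrullDim_eq_height q] at h1
  exact_mod_cast h1

theorem algebraMap_notMem_minimalPrimes (r : R) (hr : ∀ q ∈ minimalPrimes R, r ∉ q)
    (p : Ideal A) (hp : p ∈ minimalPrimes A) : algebraMap R A r ∉ p := by
  intro hrp
  obtain ⟨p', hp', rfl⟩ := Ideal.exists_comap_eq_of_mem_minimalPrimes_of_injective
    (f := (A.val.toRingHom : A →+* R[X])) Subtype.val_injective p hp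
  have : (p'.comap C).IsPrime := Ideal.comap_isPrime _ _
  obtain ⟨q, hq, hqp⟩ := Ideal.exists_minimalPrimes_le (bot_le : ⊥ ≤ p'.comap C)
  have := hq.1.1
  have : (q.map C).IsPrime := Ideal.isPrime_map_C_of_isPrime
  have h1 : p'.comap (A.val.toRingHom : A →+* R[X]) ≤ (q.map C).comap A.val.toRingHom :=
    hp.2 ⟨Ideal.comap_isPrime _ _, bot_le⟩ (Ideal.comap_mono (Ideal.map_le_iff_le_comap.mpr hqp))
  have h2 := Ideal.mem_map_C_iff.mp (h1 hrp) 0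
  refine hr q hq ?_
  have h3 : A.val.toRingHom (algebraMap R A r) = C r := rfl
  rwa [h3, coeff_C_zero] at h2

/-- The contraction to `R` of an ideal of large height has large height away from `s₀`. -/
theorem le_height_of_mem_minimalPrimes_comap [IsNoetherianRing R]
    (hA : ∀ f : R[X], ∃ k : ℕ, (C s₀) ^ k * f ∈ A) (J : Ideal A) (d : ℕ)
    (hJ : ∀ M : Ideal A, M.IsPrime → J ≤ M → algebraMap R A s₀ ∉ M → ((d + 1 : ℕ) : ℕ∞) ≤ M.height)
    (q : Ideal R) (hq : q ∈ (J.comap (algebraMap R A)).minimalPrimes) (hs : s₀ ∉ q) :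
    (d : ℕ∞) ≤ q.height := by
  obtain ⟨M, hM, hJM, rfl⟩ := Ideal.exists_comap_eq_of_mem_minimalPrimes _ q hq
  have h1 := hJ M hM hJM hs
  have h2 := h1.trans (height_le_height_comap_add_one hA M hs)
  rw [Nat.cast_add, Nat.cast_one] at h2
  exact (ENat.add_le_add_iff_right ENat.one_ne_top).mp h2

end Height

/-- A proper coset version of prime avoidance for the minimal primes of a Noetherian ring. -/
theorem exists_mem_notMem_minimalPrimes {R : Type*} [CommRing R] [IsNoetherianRing R]
    (J : Ideal R) (hJ : ∀ q ∈ minimalPrimes R, ¬ J ≤ q) (s j : R)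
    (hs : ∀ q ∈ minimalPrimes R, s ∉ q) (hj : j ∈ J) :
    ∃ z, j + s * z ∈ J ∧ ∀ q ∈ minimalPrimes R, j + s * z ∉ q := by
  classical
  have hfin := minimalPrimes.finite_of_isNoetherianRing R
  set F := hfin.toFinset
  set K : Ideal R := J ⊓ (F.filter (fun q => j ∉ q)).inf id with hK
  have hnot : ¬ ((K : Set R) ⊆
      ⋃ q ∈ (↑(F.filter (fun q => j ∈ q)) : Set (Ideal R)), (q : Set R)) := by
    rw [Ideal.subset_union_prime (f := fun q : Ideal R => q) ⊥ ⊥]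
    · rintro ⟨q, hq, hKq⟩
      rw [Finset.mem_filter, Set.Finite.mem_toFinset] at hq
      have hqp : q.IsPrime := hq.1.1.1
      rcases hqp.inf_le.mp hKq with h | h
      · exact hJ q hq.1 h
      · obtain ⟨q', hq', h'⟩ := hqp.inf_le'.mp h
        rw [Finset.mem_filter, Set.Finite.mem_toFinset] at hq'
        have : q ≤ q' := hq.1.2 hq'.1.1 h'
        exact hq'.2 (this hq.2)
    · intro q hq _ _
      rw [Finset.mem_filter, Set.Finite.mem_toFinset] at hq
      exact hq.1.1.1
  obtain ⟨z, hz, hz'⟩ := Set.not_subset.mp hnot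
  refine ⟨z, J.add_mem hj (J.mul_mem_left _ hz.1), fun q hq hmem => ?_⟩
  have hqp : q.IsPrime := hq.1.1
  by_cases hjq : j ∈ q
  · refine (hqp.mem_or_mem ((Submodule.add_mem_iff_right q hjq).mp hmem)).elim (hs q hq) fun h => ?_
    exact hz' (Set.mem_biUnion (by simpa [F] using ⟨hq, hjq⟩) h)
  · have h1 : (F.filter (fun q => j ∉ q)).inf id ≤ q :=
      Finset.inf_le (f := id) (by simpa [F] using ⟨hq, hjq⟩)
    exact hjq ((Submodule.add_mem_iff_left q (q.mul_mem_left _ (h1 hz.2))).mp hmem)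

/-- The ideal of values at `w` of the linear forms on `P`. -/
noncomputable def orderIdeal {A P : Type*} [CommRing A] [AddCommGroup P] [Module A P] (w : P) :
    Ideal A :=
  LinearMap.range (Dual.eval A P w)

theorem mem_orderIdeal {A P : Type*} [CommRing A] [AddCommGroup P] [Module A P] {w : P} {r : A} :
    r ∈ orderIdeal w ↔ ∃ φ : Dual A P, φ w = r := Iff.rfl

section

variable {R : Type*} [CommRing R] {A : Subalgebra R R[X]} {s₀ : R}
  [IsNoetherianRing A] {d : ℕ} {P : Type*}
  [AddCommGroup P] [Module A P] [Module.Finite A P] [Module.Projective A P]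

theorem exists_dual_apply_sub_one_coeff_zero [IsNoetherianRing R] (hdim : ringKrullDim R = (d : ℕ))
    (hrank : ∀ p : PrimeSpectrum A, d + 1 ≤ rankAtStalk P p) (a μ : A) (w : P) (φ : Dual A P)
    (huni : μ * a + φ w = 1) :
    ∃ (q : P) (ψ : Dual A P), ((ψ (w + a • q) : A) : R[X]).coeff 0 = 1 := by
  set I : Ideal A := RingHom.ker (constantCoeff.comp (A.val.toRingHom : A →+* R[X])) with hI
  have hmemI : ∀ x : A, x ∈ I ↔ (x : R[X]).coeff 0 = 0 := fun x => Iff.rfl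
  have hfin : ∀ p : PrimeSpectrum A, (p.asIdeal.comap (algebraMap R A)).height ≤ d := by
    intro p
    have : (p.asIdeal.comap (algebraMap R A)).IsPrime := Ideal.comap_isPrime _ _
    have h1 := Ideal.height_le_ringKrullDim_of_ne_top this.ne_top
    rw [hdim] at h1
    exact_mod_cast h1
  have hcoe : ∀ p : PrimeSpectrum A, (((p.asIdeal.comap (algebraMap R A)).height.toNat : ℕ) : ℕ∞) =
    (p.asIdeal.comap (algebraMap R A)).height := fun p =>
    ENat.natCast_toNat (ne_top_of_le_ne_top (ENat.natCast_ne_top d) (hfin p))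
  obtain ⟨q, hq⟩ := exists_dual_apply_notMem (d + 1) hrank I 1
    (fun p => (p.asIdeal.comap (algebraMap R A)).height.toNat) (by
      intro q p hIq _ hqp
      have hpp : (p.asIdeal.comap (algebraMap R A)).IsPrime := Ideal.comap_isPrime _ _
      have hqq : (q.asIdeal.comap (algebraMap R A)).IsPrime := Ideal.comap_isPrime _ _
      rw [← Nat.cast_lt (α := ℕ∞), hcoe, hcoe]
      refine Ideal.height_strict_mono_of_isPrime_of_isPrime
        (lt_of_le_not_ge (Ideal.comap_mono hqp.le) fun hle => hqp.not_ge fun x hx => ?_)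
      have h1 : x - algebraMap R A ((x : R[X]).coeff 0) ∈ I := by
        rw [hmemI]
        have : ((x - algebraMap R A ((x : R[X]).coeff 0) : A) : R[X]) =
          (x : R[X]) - C ((x : R[X]).coeff 0) := rfl
        rw [this, coeff_sub, coeff_C_zero, sub_self]
      have h2 : algebraMap R A ((x : R[X]).coeff 0) ∈ p.asIdeal :=
        by simpa using p.asIdeal.sub_mem hx (hqp.le (hIq h1))
      simpa using q.asIdeal.add_mem (hIq h1) (hle h2)) a μ w φ huni
  have htop : orderIdeal (w + a • q) ⊔ I = ⊤ := by
    by_contra hne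
    obtain ⟨M, hM, hle⟩ := Ideal.exists_le_maximal _ hne
    obtain ⟨ψ, hψ⟩ := hq ⟨M, hM.isPrime⟩ (le_sup_right.trans hle)
      (fun h => hM.ne_top ((Ideal.eq_top_iff_one _).mpr h)) (by
        have := hfin ⟨M, hM.isPrime⟩
        rw [← hcoe, Nat.cast_le] at this
        exact Nat.lt_succ_of_le this)
    rw [mul_one] at hψ
    exact hψ (hle (Ideal.mem_sup_left ⟨ψ, rfl⟩))
  obtain ⟨y, hy, i, hi, hyi⟩ := Submodule.mem_sup.mp (htop ▸ Submodule.mem_top : (1 : A) ∈ _)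
  obtain ⟨ψ, rfl⟩ := mem_orderIdeal.mp hy
  refine ⟨q, ψ, ?_⟩
  have h3 : ψ (w + a • q) = 1 - i := eq_sub_of_add_eq hyi
  rw [h3]
  have : ((1 - i : A) : R[X]) = 1 - (i : R[X]) := rfl
  rw [this, coeff_sub, (hmemI i).mp hi, coeff_one_zero, sub_zero]

/-- A form of general position: the ideal of values of a general element has height at least
`d + 1` on the locus where `c` is invertible. -/
theorem exists_orderIdeal_height (hrank : ∀ p : PrimeSpectrum A, d + 1 ≤ rankAtStalk P p) (c : A)
    (a μ : A) (w : P) (φ : Dual A P) (huni : μ * a + φ w = 1) :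
    ∃ q : P, ∀ M : Ideal A, M.IsPrime → orderIdeal (w + (a * c) • q) ≤ M → c ∉ M →
      ((d + 1 : ℕ) : ℕ∞) ≤ M.height := by
  have hcoe : ∀ p : PrimeSpectrum A, ((p.asIdeal.height.toNat : ℕ) : ℕ∞) = p.asIdeal.height :=
    fun p => ENat.natCast_toNat (Ideal.height_ne_top p.2.ne_top)
  obtain ⟨q, hq⟩ := exists_dual_apply_notMem (d + 1) hrank ⊥ c
    (fun p => p.asIdeal.height.toNat) (by
      intro q p _ _ hqp
      rw [← Nat.cast_lt (α := ℕ∞), hcoe, hcoe]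
      exact Ideal.height_strict_mono_of_isPrime_of_isPrime hqp) a μ w φ huni
  refine ⟨q, fun M hM hle hcM => ?_⟩
  by_contra hlt
  obtain ⟨ψ, hψ⟩ := hq ⟨M, hM⟩ bot_le hcM (by
    rw [← Nat.cast_lt (α := ℕ∞), hcoe]
    exact not_le.mp hlt)
  exact hψ (hle ⟨ψ, rfl⟩)

/-- An element may be moved so that it becomes unimodular modulo `s`. -/
theorem exists_orderIdeal_sup_span_eq_top (hAdim : ringKrullDim A = (d + 1 : ℕ))
    (hrank : ∀ p : PrimeSpectrum A, d + 1 ≤ rankAtStalk P p) (s : A)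
    (hs : ∀ p ∈ minimalPrimes A, s ∉ p)
    (a μ : A) (w : P) (φ : Dual A P) (huni : μ * a + φ w = 1) :
    ∃ q : P, orderIdeal (w + a • q) ⊔ Ideal.span {s} = ⊤ := by
  have hcoe : ∀ p : PrimeSpectrum A, ((p.asIdeal.height.toNat : ℕ) : ℕ∞) = p.asIdeal.height :=
    fun p => ENat.natCast_toNat (Ideal.height_ne_top p.2.ne_top)
  have hpos : ∀ p : PrimeSpectrum A, Ideal.span {s} ≤ p.asIdeal → 0 < p.asIdeal.height.toNat := by
    intro p hp
    rw [Nat.pos_iff_ne_zero]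
    intro h0
    have h1 : p.asIdeal.height = 0 := by rw [← hcoe, h0]; rfl
    rw [Ideal.height_eq_zero_iff] at h1
    exact hs _ h1 (hp (Ideal.mem_span_singleton_self s))
  obtain ⟨q, hq⟩ := exists_dual_apply_notMem (d + 1) hrank (Ideal.span {s}) 1
    (fun p => p.asIdeal.height.toNat - 1) (by
      intro q p hsq _ hqp
      have h1 : q.asIdeal.height.toNat < p.asIdeal.height.toNat := by
        rw [← Nat.cast_lt (α := ℕ∞), hcoe, hcoe]
        exact Ideal.height_strict_mono_of_isPrime_of_isPrime hqp
      have := hpos q hsq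
      show q.asIdeal.height.toNat - 1 < p.asIdeal.height.toNat - 1
      omega) a μ w φ huni
  refine ⟨q, ?_⟩
  by_contra hne
  obtain ⟨M, hM, hle⟩ := Ideal.exists_le_maximal _ hne
  obtain ⟨ψ, hψ⟩ := hq ⟨M, hM.isPrime⟩ (le_sup_right.trans hle)
    (fun h => hM.ne_top ((Ideal.eq_top_iff_one _).mpr h)) (by
      have h1 := Ideal.height_le_ringKrullDim_of_ne_top hM.ne_top
      rw [hAdim] at h1
      have h2 : M.height ≤ (d + 1 : ℕ) := by exact_mod_cast h1
      rw [← hcoe ⟨M, hM.isPrime⟩, Nat.cast_le] at h2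
      have := hpos ⟨M, hM.isPrime⟩ (le_sup_right.trans hle)
      show M.height.toNat - 1 < d + 1
      dsimp only at h2
      omega)
  rw [mul_one] at hψ
  exact hψ (hle (Ideal.mem_sup_left ⟨ψ, rfl⟩))

theorem exists_isCoprime_mem_orderIdeal [IsNoetherianRing R] (hd : 1 ≤ d)
    (hdim : ringKrullDim R = (d : ℕ))
    (hAdim : ringKrullDim A = (d + 1 : ℕ)) (hs₀ : s₀ ∈ nonZeroDivisors R)
    (hA : ∀ f : R[X], ∃ k : ℕ, (C s₀) ^ k * f ∈ A)
    (hrank : ∀ p : PrimeSpectrum A, d + 1 ≤ rankAtStalk P p) (σ : R)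
    (hσ : ∀ q ∈ minimalPrimes R, σ ∉ q) (a μ : A) (w : P) (φ : Dual A P)
    (huni : μ * a + φ w = 1) :
    ∃ s t : R, IsCoprime s t ∧ s₀ ∣ s ∧ σ ∣ s ∧ (∀ q ∈ minimalPrimes R, s * t ∉ q) ∧
      (∃ q : P, algebraMap R A s ∈ orderIdeal (w + a • q)) ∧
      (∃ q : P, algebraMap R A t ∈ orderIdeal (w + a • q)) := by
  have hs₀' : ∀ q ∈ minimalPrimes R, s₀ ∉ q := fun q hq hmem =>
    Set.disjoint_left.mp (Ideal.disjoint_nonZeroDivisors_of_mem_minimalPrimes hq) hmem hs₀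
  have hmin0 : ∀ (J : Ideal A), (∀ M : Ideal A, M.IsPrime → J ≤ M → algebraMap R A s₀ ∉ M →
      ((d + 1 : ℕ) : ℕ∞) ≤ M.height) →
      ∀ q ∈ minimalPrimes R, ¬ J.comap (algebraMap R A) ≤ q := by
    intro J hJ q hq hle
    have h1 : q ∈ (J.comap (algebraMap R A)).minimalPrimes :=
      ⟨⟨hq.1.1, hle⟩, fun q' hq' hq'q => hq.2 ⟨hq'.1, bot_le⟩ hq'q⟩
    have h2 := le_height_of_mem_minimalPrimes_comap hA J d hJ q h1 (hs₀' q hq)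
    have := hq.1.1
    rw [Ideal.height_eq_zero_iff.mpr hq] at h2
    have : d ≤ 0 := by exact_mod_cast h2
    omega
  obtain ⟨q₁, hq₁⟩ := exists_orderIdeal_height hrank 1 a μ w φ huni
  obtain ⟨s₁, hs₁, hs₁'⟩ := exists_mem_notMem_minimalPrimes _
    (hmin0 _ fun M hM h _ => hq₁ M hM h fun h => hM.ne_top ((Ideal.eq_top_iff_one _).mpr h)) 1 0
    (fun q hq h => hq.1.1.ne_top ((Ideal.eq_top_iff_one _).mpr h)) (zero_mem _)
  rw [zero_add, one_mul] at hs₁ hs₁'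
  set s := s₀ * s₁ * σ
  have hs : ∀ q ∈ minimalPrimes R, s ∉ q := fun q hq h => by
    rcases hq.1.1.mem_or_mem h with h | h
    · exact (hq.1.1.mem_or_mem h).elim (hs₀' q hq) (hs₁' q hq)
    · exact hσ q hq h
  have hss₀ : ∀ M : Ideal A, algebraMap R A s ∉ M → algebraMap R A s₀ ∉ M := by
    intro M h1 h2
    refine h1 ?_
    rw [show s = s₀ * (s₁ * σ) from mul_assoc _ _ _, map_mul]
    exact M.mul_mem_right _ h2
  obtain ⟨q₂, hq₂⟩ := exists_orderIdeal_sup_span_eq_top hAdim hrank (algebraMap R A s)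
    (algebraMap_notMem_minimalPrimes s hs) a μ w φ huni
  obtain ⟨q₃, hq₃⟩ := exists_orderIdeal_height hrank (algebraMap R A s) a (μ - φ q₂) (w + a • q₂) φ
    (by rw [map_add, map_smul, smul_eq_mul, ← huni]; ring)
  have hw : w + a • q₂ + (a * algebraMap R A s) • q₃ =
      w + a • (q₂ + algebraMap R A s • q₃) := by
    rw [smul_add, smul_smul, add_assoc]
  set w' := w + a • q₂ + (a * algebraMap R A s) • q₃
  have hsM : ∀ M : Ideal A, M.IsPrime → orderIdeal w' ≤ M → algebraMap R A s ∉ M := by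
    intro M hM hle hsM
    refine hM.ne_top (top_le_iff.mp (hq₂ ▸ sup_le ?_ ?_))
    · rintro _ ⟨ψ, rfl⟩
      have h1 : ψ w' ∈ M := hle ⟨ψ, rfl⟩
      rw [map_add, map_smul, smul_eq_mul] at h1
      exact (Submodule.add_mem_iff_left _ (M.mul_mem_right _ (M.mul_mem_left _ hsM))).mp h1
    · rwa [Ideal.span_singleton_le_iff_mem]
  have hht : ∀ M : Ideal A, M.IsPrime → orderIdeal w' ≤ M → algebraMap R A s₀ ∉ M →
      ((d + 1 : ℕ) : ℕ∞) ≤ M.height := fun M hM hle _ => hq₃ M hM hle (hsM M hM hle)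
  have htop : (orderIdeal w').comap (algebraMap R A) ⊔ Ideal.span {s} = ⊤ := by
    by_contra hne
    obtain ⟨m, hm, hle⟩ := Ideal.exists_le_maximal _ hne
    have hsm : s ∈ m := hle (Ideal.mem_sup_right (Ideal.mem_span_singleton_self s))
    obtain ⟨q, hq, hqm⟩ := Ideal.exists_minimalPrimes_le (le_sup_left.trans hle)
    obtain ⟨M, hM, hJM, hMq⟩ := Ideal.exists_comap_eq_of_mem_minimalPrimes _ q hq
    have hsq : s ∉ q := fun h => hsM M hM hJM (by rw [← hMq] at h; exact h)
    have hs₀q : s₀ ∉ q := fun h => hsq (by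
      rw [show s = s₀ * (s₁ * σ) from mul_assoc _ _ _]
      exact q.mul_mem_right _ h)
    have h1 := le_height_of_mem_minimalPrimes_comap hA _ d hht q hq hs₀q
    have := hq.1.1
    have h2 : q.height < m.height := Ideal.height_strict_mono_of_isPrime_of_isPrime
      (lt_of_le_of_ne hqm fun h => hsq (h ▸ hsm))
    have h3 := Ideal.height_le_ringKrullDim_of_ne_top hm.ne_top
    rw [hdim] at h3
    have h4 : m.height ≤ (d : ℕ∞) := by exact_mod_cast h3
    exact absurd (h1.trans_lt h2) (not_lt.mpr h4)
  obtain ⟨j, hj, y, hy, hjy⟩ := Submodule.mem_sup.mp (htop ▸ Submodule.mem_top : (1 : R) ∈ _)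
  obtain ⟨y, rfl⟩ := Ideal.mem_span_singleton'.mp hy
  obtain ⟨z, hz, hz'⟩ := exists_mem_notMem_minimalPrimes _ (hmin0 _ hht) s j hs hj
  refine ⟨s, j + s * z, ⟨y - z, 1, by linear_combination hjy⟩, ⟨s₁ * σ, mul_assoc _ _ _⟩,
    ⟨s₀ * s₁, mul_comm _ _⟩, fun q hq h => (hq.1.1.mem_or_mem h).elim (hs q hq) (hz' q hq),
    ⟨q₁, ?_⟩, ⟨_, hw ▸ hz⟩⟩
  rw [mul_one] at hs₁
  have h5 : algebraMap R A s = algebraMap R A (s₀ * σ) * algebraMap R A s₁ := by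
    rw [← map_mul]; congr 1; ring
  rw [h5]
  exact Ideal.mul_mem_left _ _ hs₁

end

/-- An idempotent matrix over a principal ideal domain is diagonalizable. -/
theorem Matrix.exists_basis_of_isIdempotentElem {S : Type*} [CommRing S] [IsDomain S]
    [IsPrincipalIdealRing S] {m : Type*} [Fintype m] [DecidableEq m] (e : Matrix m m S)
    (he : e * e = e) : ∃ b : Basis m S (m → S), ∀ j, e.toLin' (b j) = b j ∨ e.toLin' (b j) = 0 := by
  set f := e.toLin'
  have hf : ∀ x, f (f x) = f x := fun x => by
    rw [← Matrix.toLin'_mul_apply, he]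
  have hc : IsCompl (LinearMap.range f) (LinearMap.ker f) := by
    refine LinearMap.IsIdempotentElem.isCompl (LinearMap.ext hf)
  obtain ⟨n₁, b₁⟩ := Submodule.basisOfPid (Pi.basisFun S m) (LinearMap.range f)
  obtain ⟨n₂, b₂⟩ := Submodule.basisOfPid (Pi.basisFun S m) (LinearMap.ker f)
  let b := (b₁.prod b₂).map (Submodule.prodEquivOfIsCompl _ _ hc)
  let g := b.indexEquiv (Pi.basisFun S m)
  refine ⟨b.reindex g, fun j => ?_⟩
  obtain ⟨j, rfl⟩ := g.surjective j
  rw [Basis.reindex_apply, Equiv.symm_apply_apply]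
  rcases j with j | j
  · left
    have : b (Sum.inl j) = b₁ j := by simp [b]
    rw [this]
    obtain ⟨x, hx⟩ := (b₁ j).2
    rw [← hx, hf]
  · right
    have : b (Sum.inr j) = b₂ j := by simp [b]
    rw [this]
    exact (b₂ j).2

theorem Matrix.exists_conj_constant_of_field {K : Type*} [Field K] {m : Type*} [Fintype m]
    [DecidableEq m] (e : Matrix m m K[X]) (he : e * e = e) :
    ∃ (U V : Matrix m m K[X]) (E : Matrix m m K), U * V = 1 ∧ V * U = 1 ∧
      U * e * V = E.map C := by
  obtain ⟨b, hb⟩ := e.exists_basis_of_isIdempotentElem he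
  classical
  refine ⟨b.toMatrix (Pi.basisFun K[X] m), (Pi.basisFun K[X] m).toMatrix b,
    Matrix.diagonal fun j => if e.toLin' (b j) = b j then 1 else 0,
    Basis.toMatrix_mul_toMatrix_flip _ _, Basis.toMatrix_mul_toMatrix_flip _ _, ?_⟩
  have h1 : e = LinearMap.toMatrix (Pi.basisFun K[X] m) (Pi.basisFun K[X] m) e.toLin' := by
    rw [← LinearMap.toMatrix_toLin (Pi.basisFun K[X] m) (Pi.basisFun K[X] m) e]
    simp [Matrix.toLin_eq_toLin']
  conv_lhs => rw [h1, basis_toMatrix_mul_linearMap_toMatrix_mul_basis_toMatrix]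
  ext1 i j
  rw [LinearMap.toMatrix_apply, Matrix.map_apply, Matrix.diagonal_apply]
  by_cases h : e.toLin' (b j) = b j
  · rw [h, Basis.repr_self, Finsupp.single_apply]
    by_cases hij : i = j
    · subst hij; simp [h]
    · simp [hij, Ne.symm hij]
  · rw [(hb j).resolve_left h]
    by_cases hij : i = j
    · subst hij
      rw [if_pos rfl, if_neg h]
      simp
    · simp [hij]

theorem exists_common_denominator {R K : Type*} [CommRing R] [Field K] (ψ : R →+* K)
    (hψ : ∀ x : K, ∃ c r : R, ψ c ≠ 0 ∧ ψ r = ψ c * x) {ι : Type*} (F : Finset ι)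
    (f : ι → K[X]) : ∃ c : R, ψ c ≠ 0 ∧ ∀ i ∈ F, ∃ g : R[X], g.map ψ = C (ψ c) * f i := by
  have hone : ∀ f : K[X], ∃ c : R, ψ c ≠ 0 ∧ ∃ g : R[X], g.map ψ = C (ψ c) * f := by
    intro f
    induction f using Polynomial.induction_on' with
    | add p q hp hq =>
      obtain ⟨c, hc, g, hg⟩ := hp
      obtain ⟨c', hc', g', hg'⟩ := hq
      refine ⟨c * c', by rw [map_mul]; exact mul_ne_zero hc hc', C c' * g + C c * g', ?_⟩
      simp only [Polynomial.map_add, Polynomial.map_mul, map_C, hg, hg', map_mul]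
      ring
    | monomial n a =>
      obtain ⟨c, r, hc, hr⟩ := hψ a
      exact ⟨c, hc, monomial n r, by rw [map_monomial, hr, C_mul_monomial]⟩
  choose c hc g hg using hone
  classical
  refine ⟨∏ i ∈ F, c (f i), ?_, fun i hi => ⟨C (∏ j ∈ F.erase i, c (f j)) * g (f i), ?_⟩⟩
  · rw [map_prod]
    exact Finset.prod_ne_zero_iff.mpr fun i _ => hc _
  · rw [Polynomial.map_mul, map_C, hg, ← mul_assoc, ← C_mul, ← map_mul,
      Finset.prod_erase_mul _ _ hi]

theorem exists_conj_constant_mod_prime {R : Type*} [CommRing R] {m : Type*} [Fintype m]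
    [DecidableEq m] (e : Matrix m m R[X]) (he : e * e = e) (q : Ideal R) [q.IsPrime] :
    ∃ (c : R) (U V : Matrix m m R[X]) (E : Matrix m m R), c ∉ q ∧
      (∀ i j n, ((U * V - c ^ 2 • (1 : Matrix m m R[X])) i j).coeff n ∈ q) ∧
      (∀ i j n, ((V * U - c ^ 2 • (1 : Matrix m m R[X])) i j).coeff n ∈ q) ∧
      (∀ i j n, ((U * e * V - c • E.map C) i j).coeff n ∈ q) := by
  set K := FractionRing (R ⧸ q)
  set ψ : R →+* K := (algebraMap (R ⧸ q) K).comp (Ideal.Quotient.mk q)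
  have hker : ∀ r, ψ r = 0 ↔ r ∈ q := fun r => by
    rw [RingHom.comp_apply, FaithfulSMul.algebraMap_eq_zero_iff, Ideal.Quotient.eq_zero_iff_mem]
  have hψ : ∀ x : K, ∃ c r : R, ψ c ≠ 0 ∧ ψ r = ψ c * x := by
    intro x
    obtain ⟨r, c, hc, rfl⟩ := IsFractionRing.div_surjective (A := R ⧸ q) x
    obtain ⟨r, rfl⟩ := Ideal.Quotient.mk_surjective r
    obtain ⟨c, rfl⟩ := Ideal.Quotient.mk_surjective c
    have h0 : ψ c ≠ 0 := by
      rw [Ne, hker, ← Ideal.Quotient.eq_zero_iff_mem]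
      exact nonZeroDivisors.ne_zero hc
    exact ⟨c, r, h0, (mul_div_cancel₀ _ h0).symm⟩
  obtain ⟨U, V, E, hUV, hVU, hE⟩ := (e.map (mapRingHom ψ)).exists_conj_constant_of_field (by
    rw [← Matrix.map_mul, he])
  obtain ⟨c, hc, hcc⟩ := exists_common_denominator ψ hψ (Finset.univ : Finset (Fin 3 × m × m))
    (fun x => (![U, V, E.map C] x.1 : Matrix m m K[X]) x.2.1 x.2.2)
  choose g hg using fun x => hcc x (Finset.mem_univ x)
  let U' : Matrix m m R[X] := fun i j => g (0, i, j)
  let V' : Matrix m m R[X] := fun i j => g (1, i, j)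
  let E' : Matrix m m R := fun i j => (g (2, i, j)).coeff 0
  have hU' : U'.map (mapRingHom ψ) = ψ c • U := by
    ext1 i j
    simp only [Matrix.map_apply, Matrix.smul_apply, smul_eq_C_mul]
    exact hg (0, i, j)
  have hV' : V'.map (mapRingHom ψ) = ψ c • V := by
    ext1 i j
    simp only [Matrix.map_apply, Matrix.smul_apply, smul_eq_C_mul]
    exact hg (1, i, j)
  have hE' : (E'.map C).map (mapRingHom ψ) = ψ c • (E.map C : Matrix m m K[X]) := by
    ext1 i j
    simp only [Matrix.map_apply, Matrix.smul_apply, smul_eq_C_mul, coe_mapRingHom, map_C]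
    have h1 := congrArg (fun f => f.coeff 0) (hg (2, i, j))
    simp at h1
    simp [E', h1]
  have hmem : ∀ M : Matrix m m R[X], M.map (mapRingHom ψ) = 0 → ∀ i j n, (M i j).coeff n ∈ q := by
    intro M hM i j n
    have h1 : ((M.map (mapRingHom ψ)) i j).coeff n = 0 := by rw [hM]; simp
    rw [← hker]
    simpa using h1
  have hsmul : ∀ (r : R) (M : Matrix m m R[X]),
      (r • M).map (mapRingHom ψ) = ψ r • M.map (mapRingHom ψ) := by
    intro r M
    ext1 i j
    simp [smul_eq_C_mul]
  have hone : (1 : Matrix m m R[X]).map (mapRingHom ψ) = 1 :=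
    Matrix.map_one _ (map_zero _) (map_one _)
  refine ⟨c, U', V', E', fun h => hc ((hker c).mpr h), hmem _ ?_, hmem _ ?_, hmem _ ?_⟩
  · rw [Matrix.map_sub _ (map_sub _), Matrix.map_mul, hU', hV', hsmul, hone,
      smul_mul_smul_comm, hUV, map_pow, sq, sub_self]
  · rw [Matrix.map_sub _ (map_sub _), Matrix.map_mul, hU', hV', hsmul, hone,
      smul_mul_smul_comm, hVU, map_pow, sq, sub_self]
  · rw [Matrix.map_sub _ (map_sub _), Matrix.map_mul, Matrix.map_mul, hU', hV', hsmul, hE',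
      smul_mul_assoc, smul_mul_smul_comm, hE, smul_smul, sub_self]

/-- Over a reduced Noetherian ring, an idempotent matrix of polynomials becomes conjugate to a
constant matrix after inverting an element outside all minimal primes. -/
theorem exists_conj_constant {R : Type*} [CommRing R] [IsNoetherianRing R] [IsReduced R]
    {m : Type*} [Fintype m] [DecidableEq m] (e : Matrix m m R[X]) (he : e * e = e) :
    ∃ (σ : R) (U V : Matrix m m R[X]) (E : Matrix m m R), (∀ q ∈ minimalPrimes R, σ ∉ q) ∧
      U * V = σ ^ 2 • (1 : Matrix m m R[X]) ∧ V * U = σ ^ 2 • (1 : Matrix m m R[X]) ∧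
      U * e * V = σ • E.map C := by
  classical
  have hfin := minimalPrimes.finite_of_isNoetherianRing R
  have := hfin.fintype
  have hpr : ∀ q : minimalPrimes R, q.1.IsPrime := fun q => q.2.1.1
  have hzero : ∀ x : R, (∀ q : minimalPrimes R, x ∈ q.1) → x = 0 := by
    intro x hx
    have h1 : x ∈ sInf (minimalPrimes R) := by
      rw [Submodule.mem_sInf]
      exact fun q hq => hx ⟨q, hq⟩
    rw [minimalPrimes, Ideal.sInf_minimalPrimes] at h1
    exact (mem_nilradical.mp h1).eq_zero
  have hr : ∀ q : minimalPrimes R, ∃ r : R, r ∉ q.1 ∧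
      ∀ q' : minimalPrimes R, q' ≠ q → r ∈ q'.1 := by
    intro q
    have h1 : ¬ (Finset.univ.erase q).inf (fun q' : minimalPrimes R => q'.1) ≤ q.1 := by
      intro h
      obtain ⟨q', hq', hle⟩ := (hpr q).inf_le'.mp h
      exact Finset.ne_of_mem_erase hq' (Subtype.ext (le_antisymm hle (q.2.2 q'.2.1 hle)))
    obtain ⟨r, hr, hr'⟩ := Set.not_subset.mp h1
    exact ⟨r, hr', fun q' hq' => (Finset.inf_le (Finset.mem_erase.mpr ⟨hq', Finset.mem_univ _⟩) :
      _ ≤ q'.1) hr⟩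
  choose r hrq hr using hr
  choose c U V E hc hUV hVU hE using fun q : minimalPrimes R =>
    have := hpr q
    exists_conj_constant_mod_prime e he q.1
  have hrr : ∀ i j, i ≠ j → r i * r j = 0 := fun i j hij => hzero _ fun q => by
    by_cases h : q = i
    · exact q.1.mul_mem_left _ (hr j q (h ▸ hij))
    · exact q.1.mul_mem_right _ (hr i q h)
  have hkill : ∀ q (M N : Matrix m m R[X]), (∀ i j n, ((M - N) i j).coeff n ∈ q.1) →
      r q • M = r q • N := by
    intro q M N h
    rw [← sub_eq_zero, ← smul_sub]
    ext i j n
    rw [Matrix.smul_apply, coeff_smul, smul_eq_mul]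
    refine hzero _ fun q' => ?_
    by_cases hq : q' = q
    · exact q'.1.mul_mem_left _ (hq ▸ h i j n)
    · exact q'.1.mul_mem_right _ (hr q q' hq)
  have hmul : ∀ X Y : minimalPrimes R → Matrix m m R[X],
      (∑ q, r q • X q) * (∑ q, r q • Y q) = ∑ q, r q • r q • (X q * Y q) := by
    intro X Y
    rw [Finset.sum_mul_sum]
    refine Finset.sum_congr rfl fun q _ => ?_
    rw [Finset.sum_eq_single q]
    · rw [smul_mul_smul_comm, mul_smul]
    · intro q' _ hq'
      rw [smul_mul_smul_comm, hrr _ _ hq'.symm, zero_smul]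
    · simp
  have hσ : ∀ M : minimalPrimes R → Matrix m m R[X],
      (∑ q, r q * c q) • ∑ q, r q • M q = ∑ q, r q • r q • c q • M q := by
    intro M
    rw [Finset.sum_smul]
    refine Finset.sum_congr rfl fun q _ => ?_
    rw [Finset.smul_sum, Finset.sum_eq_single q]
    · simp only [smul_smul]; congr 1; ring
    · intro q' _ hq'
      rw [smul_smul, mul_right_comm, hrr _ _ hq'.symm, zero_mul, zero_smul]
    · simp
  have hσ2 : (∑ q, r q * c q) ^ 2 • (1 : Matrix m m R[X]) =
      ∑ q, r q • r q • c q ^ 2 • (1 : Matrix m m R[X]) := by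
    have := hσ (fun q => c q • 1)
    simp only [smul_smul, ← Finset.sum_smul] at this ⊢
    rw [sq, this]
    congr 1
    exact Finset.sum_congr rfl fun q _ => by ring
  refine ⟨∑ q, r q * c q, ∑ q, r q • U q, ∑ q, r q • V q, ∑ q, r q • E q, ?_, ?_, ?_, ?_⟩
  · intro q hq hmem
    rw [← Finset.add_sum_erase _ _ (Finset.mem_univ ⟨q, hq⟩)] at hmem
    refine (hq.1.1.mem_or_mem ((Submodule.add_mem_iff_left _ ?_).mp hmem)).elim (hrq ⟨q, hq⟩)
      (hc ⟨q, hq⟩)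
    exact q.sum_mem fun q' hq' =>
      q.mul_mem_right _ (hr q' ⟨q, hq⟩ (Finset.ne_of_mem_erase hq').symm)
  · rw [hmul, hσ2]
    exact Finset.sum_congr rfl fun q _ => by rw [hkill q _ _ (hUV q)]
  · rw [hmul, hσ2]
    exact Finset.sum_congr rfl fun q _ => by rw [hkill q _ _ (hVU q)]
  · have h1 : (∑ q, r q • U q) * e = ∑ q, r q • (U q * e) := by
      rw [Finset.sum_mul]
      exact Finset.sum_congr rfl fun q _ => smul_mul_assoc _ _ _
    have h2 : ((∑ q, r q • E q).map C : Matrix m m R[X]) = ∑ q, r q • (E q).map C := by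
      ext1 i j
      simp [Matrix.sum_apply, smul_eq_C_mul]
    rw [h1, hmul, h2, hσ]
    exact Finset.sum_congr rfl fun q _ => by rw [hkill q _ _ (hE q)]

section Splitting

variable {A B : Type*} [CommRing A] [CommRing B] (g : A →+* B) {m : Type*} [Fintype m]

theorem smul_mem_range_mapMatrix [DecidableEq m] (a : A) {M : Matrix m m B}
    (hM : M ∈ g.mapMatrix.range) :
    g a • M ∈ (g.mapMatrix : Matrix m m A →+* Matrix m m B).range := by
  obtain ⟨N, rfl⟩ := hM
  refine ⟨a • N, ?_⟩
  ext i j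
  simp

theorem exists_pow_mul_mem_range_mapRingHom (u : A)
    (hsurj : ∀ b : B, ∃ (k : ℕ) (a : A), g a = g u ^ k * b) (p : B[X]) :
    ∃ k : ℕ, ∀ l ≥ k, C (g u) ^ l * p ∈ (mapRingHom g).range := by
  have hCu : C (g u) ∈ (mapRingHom g).range := ⟨C u, by simp⟩
  induction p using Polynomial.induction_on' with
  | add p q hp hq =>
    obtain ⟨k, hk⟩ := hp
    obtain ⟨k', hk'⟩ := hq
    refine ⟨max k k', fun l hl => ?_⟩
    rw [mul_add]
    exact add_mem (hk l (le_trans (le_max_left _ _) hl)) (hk' l (le_trans (le_max_right _ _) hl))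
  | monomial n b =>
    obtain ⟨k, a, ha⟩ := hsurj b
    refine ⟨k, fun l hl => ?_⟩
    obtain ⟨l, rfl⟩ := Nat.exists_eq_add_of_le hl
    rw [pow_add, mul_comm (C (g u) ^ k), mul_assoc]
    refine mul_mem (pow_mem hCu l) ⟨monomial n a, ?_⟩
    rw [coe_mapRingHom, map_monomial, ha, ← C_mul_monomial, C_pow]

theorem exists_pow_mul_apply_mem_range_mapRingHom (u : A)
    (hsurj : ∀ b : B, ∃ (k : ℕ) (a : A), g a = g u ^ k * b) (M : Matrix m m B[X]) :
    ∃ k : ℕ, ∀ l ≥ k, ∀ i j, C (g u) ^ l * M i j ∈ (mapRingHom g).range := by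
  choose k hk using fun x : m × m => exists_pow_mul_mem_range_mapRingHom g u hsurj (M x.1 x.2)
  exact ⟨Finset.univ.sup k, fun l hl i j =>
    hk (i, j) l (le_trans (Finset.le_sup (Finset.mem_univ (i, j))) hl)⟩

theorem smul_map_eval_mem_range_mapMatrix [DecidableEq m] (u : A) (k : ℕ) (M : Matrix m m B[X])
    (hM : ∀ i j, C (g u) ^ k * M i j ∈ (mapRingHom g).range) (b : A) :
    g u ^ k • M.map (eval (g b)) ∈ (g.mapMatrix : Matrix m m A →+* Matrix m m B).range := by
  choose P hP using hM
  refine ⟨fun i j => (P i j).eval b, ?_⟩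
  ext i j
  have h := congrArg (eval (g b)) (hP i j)
  rw [coe_mapRingHom, eval_map_apply, eval_mul, eval_pow, eval_C] at h
  exact h

theorem exists_map_eval_sub_map_eval [DecidableEq m] (u : A) (hu : IsUnit (g u)) (k : ℕ)
    (M : Matrix m m B[X])
    (hM : ∀ i j, C (g u) ^ k * M i j ∈ (mapRingHom g).range) (b c : A) :
    ∃ D : Matrix m m B, M.map (eval (g b)) - M.map (eval (g c)) = g (b - c) • D ∧
      g u ^ k • D ∈ (g.mapMatrix : Matrix m m A →+* Matrix m m B).range := by
  choose P hP using hM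
  choose Q hQ using fun i j => sub_dvd_eval_sub b c (P i j)
  obtain ⟨w, hw⟩ := (hu.pow k).exists_left_inv
  refine ⟨fun i j => w * g (Q i j), ?_, fun i j => Q i j, ?_⟩
  · ext i j
    have hb := congrArg (eval (g b)) (hP i j)
    have hc := congrArg (eval (g c)) (hP i j)
    rw [coe_mapRingHom, eval_map_apply, eval_mul, eval_pow, eval_C] at hb hc
    have h := congrArg g (hQ i j)
    rw [map_sub, hb, hc, map_mul] at h
    change eval (g b) (M i j) - eval (g c) (M i j) = g (b - c) * (w * g (Q i j))
    linear_combination w * h - (eval (g b) (M i j) - eval (g c) (M i j)) * hw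
  · ext i j
    change g (Q i j) = g u ^ k * (w * g (Q i j))
    linear_combination - g (Q i j) * hw

end Splitting

section Homotopy

variable {K : Type*} [CommRing K] {m : Type*} [Fintype m]

/-- The homotopy `f(X) ↦ f(XY)`. -/
noncomputable def scaleHom (K : Type*) [CommRing K] : K[X] →+* K[X][X] :=
  eval₂RingHom (C.comp C) (C X * X)

/-- The conjugate by `U` of the homotopy `f(X) ↦ f(XY)`, where `V` is the inverse of `U`. -/
noncomputable def conjScale (U V θ : Matrix m m K[X]) : Matrix m m K[X][X] :=
  V.map C * (U * θ * V).map (scaleHom K) * U.map C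

theorem conjScale_mul [DecidableEq m] {U V : Matrix m m K[X]} (hUV : U * V = 1) (hVU : V * U = 1)
    (θ η : Matrix m m K[X]) :
    conjScale U V θ * conjScale U V η = conjScale U V (θ * η) := by
  have h1 : (U.map C * V.map C : Matrix m m K[X][X]) = 1 := by
    rw [← Matrix.map_mul, hUV, Matrix.map_one _ C_0 C_1]
  have h2 : U * (θ * η) * V = (U * θ * V) * (U * η * V) := by
    calc U * (θ * η) * V = U * θ * 1 * η * V := by simp only [mul_one, mul_assoc]
      _ = _ := by rw [← hVU]; simp only [mul_assoc]
  have h3 : ∀ M N : Matrix m m K[X][X],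
      V.map C * M * U.map C * (V.map C * N * U.map C) = V.map C * (M * N) * U.map C := by
    intro M N
    calc _ = V.map C * M * (U.map C * V.map C) * N * U.map C := by simp only [mul_assoc]
      _ = _ := by rw [h1, mul_one]; simp only [mul_assoc]
  rw [conjScale, conjScale, conjScale, h3, h2, ← Matrix.map_mul]

theorem map_eval_conjScale (U V θ : Matrix m m K[X]) (b : K[X]) :
    (conjScale U V θ).map (eval b) = V * (U * θ * V).map (fun f => f.comp (X * b)) * U := by
  have h1 : ∀ M : Matrix m m K[X], (M.map C).map (eval b) = M := fun M => by ext1 i j; simp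
  have h2 : ∀ M : Matrix m m K[X], (M.map (scaleHom K)).map (eval b) =
      M.map (fun f => f.comp (X * b)) := fun M => by
    ext1 i j
    simp only [Matrix.map_apply, scaleHom, coe_eval₂RingHom]
    induction M i j using Polynomial.induction_on' with
    | add p q hp hq => rw [eval₂_add, eval_add, hp, hq, add_comp]
    | monomial n a => simp [eval₂_monomial, mul_pow]
  have h3 : ∀ M N : Matrix m m K[X][X], (M * N).map (eval b) = M.map (eval b) * N.map (eval b) :=
    fun M N => by
      rw [← coe_evalRingHom, Matrix.map_mul]
  rw [conjScale, h3, h3, h1, h1, h2]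

theorem map_eval_one_conjScale [DecidableEq m] {U V : Matrix m m K[X]} (hVU : V * U = 1)
    (θ : Matrix m m K[X]) : (conjScale U V θ).map (eval 1) = θ := by
  rw [map_eval_conjScale]
  have : (U * θ * V).map (fun f => f.comp (X * 1)) = U * θ * V := by ext1 i j; simp
  rw [this]
  calc _ = (V * U) * θ * (V * U) := by simp only [mul_assoc]
    _ = θ := by rw [hVU, one_mul, mul_one]

theorem conjScale_eq_map_C [DecidableEq m] {U V e : Matrix m m K[X]} {E : Matrix m m K}
    (hVU : V * U = 1)
    (hE : U * e * V = E.map C) : conjScale U V e = e.map C := by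
  have h1 : (E.map C).map (scaleHom K) = (E.map C).map C := by
    ext1 i j
    simp [scaleHom]
  have h2 : V * (U * e * V) * U = e := by
    calc _ = (V * U) * e * (V * U) := by simp only [mul_assoc]
      _ = e := by rw [hVU, one_mul, mul_one]
  rw [conjScale, hE, h1, ← Matrix.map_mul, ← Matrix.map_mul, ← hE, h2]

theorem map_eval_zero_conjScale [DecidableEq m] {U V e θ : Matrix m m K[X]} {E : Matrix m m K}
    (hVU : V * U = 1)
    (hE : U * e * V = E.map C) (hθ : θ.map constantCoeff = e.map constantCoeff) :
    (conjScale U V θ).map (eval 0) = e := by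
  have h1 : ∀ M : Matrix m m K[X], M.map (fun f => f.comp (X * 0)) =
      (M.map constantCoeff).map C := fun M => by
    ext1 i j
    simp [coeff_zero_eq_eval_zero]
  have h2 : (E.map C).map constantCoeff = E := by ext1 i j; simp
  have h3 : (U * θ * V).map constantCoeff = (U * e * V).map constantCoeff := by
    simp only [Matrix.map_mul, hθ]
  rw [map_eval_conjScale, h1, h3, hE, h2, ← hE]
  calc _ = (V * U) * e * (V * U) := by simp only [mul_assoc]
    _ = e := by rw [hVU, one_mul, mul_one]

/-- The Quillen splitting lemma for automorphisms of the image of an idempotent matrix that are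
trivial at `X = 0`. -/
theorem exists_quillen_splitting [DecidableEq m] {A : Type*} [CommRing A] (g : A →+* K[X]) (s t : A)
    (hcop : IsCoprime s t) (hu : IsUnit (g (s * t)))
    (hsurj : ∀ b : K[X], ∃ (k : ℕ) (a : A), g a = g (s * t) ^ k * b)
    {e θ θ' U V : Matrix m m K[X]} {E : Matrix m m K} (hUV : U * V = 1) (hVU : V * U = 1)
    (hE : U * e * V = E.map C) (he : e ∈ g.mapMatrix.range) (heθ : e * θ = θ) (hθe : θ * e = θ)
    (heθ' : e * θ' = θ') (hθe' : θ' * e = θ') (hθθ' : θ * θ' = e) (hθ'θ : θ' * θ = e)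
    (h0 : θ.map constantCoeff = e.map constantCoeff) :
    ∃ (n : ℕ) (F F' G G' : Matrix m m K[X]),
      (g s ^ n • F ∈ g.mapMatrix.range ∧ g s ^ n • F' ∈ g.mapMatrix.range ∧
        g t ^ n • G ∈ g.mapMatrix.range ∧ g t ^ n • G' ∈ g.mapMatrix.range) ∧
      (e * F = F ∧ F * e = F) ∧ (e * F' = F' ∧ F' * e = F') ∧
      (e * G = G ∧ G * e = G) ∧ (e * G' = G' ∧ G' * e = G') ∧
      F * F' = e ∧ G * G' = e ∧ F * θ * G' = e ∧ G * θ' * F' = e := by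
  have h0' : θ'.map constantCoeff = e.map constantCoeff := by
    calc θ'.map constantCoeff = (θ' * e).map constantCoeff := by rw [hθe']
      _ = (θ' * θ).map constantCoeff := by rw [Matrix.map_mul, Matrix.map_mul, h0]
      _ = _ := by rw [hθ'θ]
  set Θ := conjScale U V θ
  set Θ' := conjScale U V θ'
  obtain ⟨k₁, hk₁⟩ := exists_pow_mul_apply_mem_range_mapRingHom g (s * t) hsurj Θ
  obtain ⟨k₂, hk₂⟩ := exists_pow_mul_apply_mem_range_mapRingHom g (s * t) hsurj Θ'
  set k := max k₁ k₂
  have hΘ := hk₁ k (le_max_left _ _)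
  have hΘ' := hk₂ k (le_max_right _ _)
  obtain ⟨x, y, hxy⟩ := hcop.pow (m := 2 * k) (n := 2 * k)
  set b := y * t ^ (2 * k) with hb
  have hT : ∀ (c : A) (α β : Matrix m m K[X]), (conjScale U V α).map (eval (g c)) *
      (conjScale U V β).map (eval (g c)) = (conjScale U V (α * β)).map (eval (g c)) := by
    intro c α β
    rw [← conjScale_mul hUV hVU, ← coe_evalRingHom, Matrix.map_mul]
  have hTe : (conjScale U V e).map (eval (g b)) = e := by
    rw [conjScale_eq_map_C hVU hE]
    ext1 i j; simp
  have hone : Θ.map (eval (g 1)) = θ := by rw [map_one]; exact map_eval_one_conjScale hVU θ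
  have hone' : Θ'.map (eval (g 1)) = θ' := by rw [map_one]; exact map_eval_one_conjScale hVU θ'
  have hzero : Θ.map (eval (g 0)) = e := by rw [map_zero]; exact map_eval_zero_conjScale hVU hE h0
  have hzero' : Θ'.map (eval (g 0)) = e := by
    rw [map_zero]; exact map_eval_zero_conjScale hVU hE h0'
  set F := Θ'.map (eval (g b))
  set F' := Θ.map (eval (g b))
  have hFF' : F * F' = e := by rw [hT, hθ'θ, hTe]
  have hF'F : F' * F = e := by rw [hT, hθθ', hTe]
  have heF : e * F = F := by
    calc e * F = (conjScale U V e).map (eval (g b)) * F := by rw [hTe]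
      _ = F := by rw [hT, heθ']
  have hFe : F * e = F := by
    calc F * e = F * (conjScale U V e).map (eval (g b)) := by rw [hTe]
      _ = F := by rw [hT, hθe']
  have heF' : e * F' = F' := by
    calc e * F' = (conjScale U V e).map (eval (g b)) * F' := by rw [hTe]
      _ = F' := by rw [hT, heθ]
  have hF'e : F' * e = F' := by
    calc F' * e = F' * (conjScale U V e).map (eval (g b)) := by rw [hTe]
      _ = F' := by rw [hT, hθe]
  have hs : ∀ M : Matrix m m K[X][X], (∀ i j, C (g (s * t)) ^ k * M i j ∈ (mapRingHom g).range) →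
      M.map (eval (g 0)) = e → g s ^ (2 * k) • M.map (eval (g b)) ∈ g.mapMatrix.range := by
    intro M hM hM0
    obtain ⟨D, hD, hDr⟩ := exists_map_eval_sub_map_eval g (s * t) hu k M hM b 0
    rw [hM0, sub_eq_iff_eq_add] at hD
    rw [hD, smul_add, ← map_pow]
    refine add_mem ?_ (smul_mem_range_mapMatrix g _ he)
    rw [smul_smul, ← map_mul, sub_zero, hb, show s ^ (2 * k) * (y * t ^ (2 * k)) =
      (y * (s * t) ^ k) * (s * t) ^ k by ring, map_mul, mul_smul, map_pow g (s * t)]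
    exact smul_mem_range_mapMatrix g _ hDr
  have h1b : 1 - b = x * s ^ (2 * k) := by rw [hb, ← hxy]; ring
  have hθr : g (s * t) ^ k • θ ∈ g.mapMatrix.range :=
    hone ▸ smul_map_eval_mem_range_mapMatrix g (s * t) k Θ hΘ 1
  have hθr' : g (s * t) ^ k • θ' ∈ g.mapMatrix.range :=
    hone' ▸ smul_map_eval_mem_range_mapMatrix g (s * t) k Θ' hΘ' 1
  have ht : g t ^ (2 * k) * g (1 - b) = g x * (g (s * t) ^ k * g (s * t) ^ k) := by
    rw [h1b]
    simp only [map_mul, map_pow]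
    ring
  refine ⟨2 * k, F, F', F * θ, θ' * F', ⟨hs _ hΘ' hzero', hs _ hΘ hzero, ?_, ?_⟩, ⟨heF, hFe⟩,
    ⟨heF', hF'e⟩, ⟨by rw [← mul_assoc, heF], by rw [mul_assoc, hθe]⟩,
    ⟨by rw [← mul_assoc, heθ'], by rw [mul_assoc, hF'e]⟩, hFF', ?_, ?_, ?_⟩
  · obtain ⟨D, hD, hDr⟩ := exists_map_eval_sub_map_eval g (s * t) hu k Θ' hΘ' 1 b
    rw [hone', sub_eq_iff_eq_add, ← sub_eq_iff_eq_add'] at hD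
    change g t ^ (2 * k) • (Θ'.map (eval (g b)) * θ) ∈ _
    rw [← hD, sub_mul, hθ'θ, smul_sub, smul_mul_assoc, smul_smul, ht, mul_smul,
      ← smul_mul_smul_comm, ← map_pow g t]
    exact sub_mem (smul_mem_range_mapMatrix g _ he)
      (smul_mem_range_mapMatrix g _ (mul_mem hDr hθr))
  · obtain ⟨D, hD, hDr⟩ := exists_map_eval_sub_map_eval g (s * t) hu k Θ hΘ 1 b
    rw [hone, sub_eq_iff_eq_add, ← sub_eq_iff_eq_add'] at hD
    change g t ^ (2 * k) • (θ' * Θ.map (eval (g b))) ∈ _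
    rw [← hD, mul_sub, hθ'θ, smul_sub, mul_smul_comm, smul_smul, ht, mul_smul,
      ← smul_mul_smul_comm, ← map_pow g t]
    exact sub_mem (smul_mem_range_mapMatrix g _ he)
      (smul_mem_range_mapMatrix g _ (mul_mem hθr' hDr))
  · calc F * θ * (θ' * F') = F * (θ * θ') * F' := by simp only [mul_assoc]
      _ = e := by rw [hθθ', hFe, hFF']
  · calc F * θ * (θ' * F') = F * (θ * θ') * F' := by simp only [mul_assoc]
      _ = e := by rw [hθθ', hFe, hFF']
  · calc F * θ * θ' * F' = F * (θ * θ') * F' := by simp only [mul_assoc]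
      _ = e := by rw [hθθ', hFe, hFF']

end Homotopy

section EndMatrix

variable {A P : Type*} [CommRing A] [AddCommGroup P] [Module A P] {m : Type*} [Fintype m]
  [DecidableEq m]

/-- The matrix of `ι ∘ f ∘ ρ`, for an endomorphism `f` of a retract `P` of a free module. -/
noncomputable def endMatrix (ι : P →ₗ[A] m → A) (ρ : (m → A) →ₗ[A] P) :
    Module.End A P →ₗ[A] Matrix m m A where
  toFun f := LinearMap.toMatrix' (ι ∘ₗ f ∘ₗ ρ)
  map_add' f h := by rw [LinearMap.add_comp, LinearMap.comp_add, map_add]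
  map_smul' c f := by rw [LinearMap.smul_comp, LinearMap.comp_smul, map_smul, RingHom.id_apply]

variable {ι : P →ₗ[A] m → A} {ρ : (m → A) →ₗ[A] P}

theorem toLin'_endMatrix (ι : P →ₗ[A] m → A) (ρ : (m → A) →ₗ[A] P) (f : Module.End A P) :
    Matrix.toLin' (endMatrix ι ρ f) = ι ∘ₗ f ∘ₗ ρ :=
  LinearMap.toMatrix'.symm_apply_apply (ι ∘ₗ f ∘ₗ ρ)

theorem endMatrix_mul (hρι : ∀ y, ρ (ι y) = y) (f h : Module.End A P) :
    endMatrix ι ρ (f * h) = endMatrix ι ρ f * endMatrix ι ρ h := by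
  apply Matrix.toLin'.injective
  rw [Matrix.toLin'_mul, toLin'_endMatrix, toLin'_endMatrix, toLin'_endMatrix]
  ext x i
  simp [hρι]

theorem exists_endMatrix_eq {M : Matrix m m A}
    (hM : endMatrix ι ρ 1 * M * endMatrix ι ρ 1 = M) : ∃ f, endMatrix ι ρ f = M := by
  refine ⟨ρ ∘ₗ Matrix.toLin' M ∘ₗ ι, Matrix.toLin'.injective ?_⟩
  conv_rhs => rw [← hM, Matrix.toLin'_mul, Matrix.toLin'_mul, toLin'_endMatrix]
  rw [toLin'_endMatrix]
  rfl

/-- An endomorphism that is the identity modulo nilpotents is surjective. -/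
theorem surjective_of_endMatrix_eq [Module.Finite A P] (hρι : ∀ y, ρ (ι y) = y)
    {B : Type*} [CommRing B] (g : A →+* B) (hg : ∀ x, g x = 0 → IsNilpotent x)
    {f : Module.End A P}
    (hf : g.mapMatrix (endMatrix ι ρ f) = g.mapMatrix (endMatrix ι ρ 1)) :
    Function.Surjective f := by
  rw [← LinearMap.range_eq_top, ← top_le_iff]
  refine Submodule.le_of_le_smul_of_le_jacobson_bot (I := nilradical A) Module.Finite.fg_top ?_ ?_
  · rw [Ideal.jacobson_bot]
    exact nilradical_le_jacobson A
  · intro y _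
    have h1 : endMatrix ι ρ (1 - f) = LinearMap.toMatrix' (ι ∘ₗ (1 - f) ∘ₗ ρ) := rfl
    have h2 : ι ((1 - f) y) = (endMatrix ι ρ (1 - f)).mulVec (ι y) := by
      rw [h1, LinearMap.toMatrix'_mulVec]
      simp [hρι]
    have h3 : ∀ i j, endMatrix ι ρ (1 - f) i j ∈ nilradical A := by
      intro i j
      refine hg _ ?_
      have h : g.mapMatrix (endMatrix ι ρ (1 - f)) = 0 := by rw [map_sub, map_sub, hf, sub_self]
      exact congrFun (congrFun h i) j
    have h4 : y = f y + ρ (ι ((1 - f) y)) := by rw [hρι]; simp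
    rw [h4]
    refine Submodule.add_mem_sup (LinearMap.mem_range_self f y) ?_
    rw [pi_eq_sum_univ (ι ((1 - f) y)), map_sum]
    refine Submodule.sum_mem _ fun i _ => ?_
    rw [map_smul]
    refine Submodule.smul_mem_smul ?_ trivial
    rw [h2]
    exact Ideal.sum_mem _ fun j _ => Ideal.mul_mem_right _ _ (h3 i j)

end EndMatrix

theorem bijective_of_surjective_of_prod_equiv {A P Q : Type*} [CommRing A] [AddCommGroup P]
    [Module A P] [AddCommGroup Q] [Module A Q] [Module.Finite A Q] (Φ : (A × Q) ≃ₗ[A] (A × P))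
    (γ : Q →ₗ[A] P) (hγ : Function.Surjective γ) : Function.Bijective γ := by
  refine ⟨fun x y hxy => ?_, hγ⟩
  have h1 : Function.Surjective (Φ.symm.toLinearMap ∘ₗ LinearMap.prodMap LinearMap.id γ) :=
    Φ.symm.surjective.comp (Function.surjective_id.prodMap hγ)
  have h2 := OrzechProperty.injective_of_surjective_endomorphism _ h1
  have h3 : ((0 : A), x) = (0, y) := h2 (by simp [hxy])
  exact congrArg Prod.snd h3

section Complement

variable {A P Q : Type*} [CommRing A] [AddCommGroup P] [Module A P] [AddCommGroup Q] [Module A Q]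

theorem exists_smul_add_apply_eq_one (Φ : (A × Q) ≃ₗ[A] (A × P)) :
    ∃ (μ : A) (φ : Dual A P), μ * (Φ (1, 0)).1 + φ (Φ (1, 0)).2 = 1 := by
  set l : (A × P) →ₗ[A] A := LinearMap.fst A A Q ∘ₗ Φ.symm.toLinearMap
  refine ⟨l (1, 0), l ∘ₗ LinearMap.inr A A P, ?_⟩
  have h : l (Φ (1, 0)) = 1 := by simp [l]
  generalize Φ (1, 0) = z at h
  have hz : z = z.1 • (1, 0) + (0, z.2) := by ext <;> simp
  refine Eq.trans ?_ h
  conv_rhs => rw [hz, map_add, map_smul, smul_eq_mul, mul_comm]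
  rfl

theorem exists_equiv_fst_eq (Φ : (A × Q) ≃ₗ[A] (A × P)) (q : P) (φ : Dual A P) :
    ∃ Φ' : (A × Q) ≃ₗ[A] (A × P), 1 - (Φ' (1, 0)).1 =
      (1 - (Φ (1, 0)).1) * (1 - φ ((Φ (1, 0)).2 + (Φ (1, 0)).1 • q)) := by
  set a := (Φ (1, 0)).1 with ha
  set ε : (A × P) ≃ₗ[A] (A × P) :=
    LinearEquiv.skewProd (.refl A A) (.refl A P) (LinearMap.toSpanSingleton A P q)
  set ε' : (P × A) ≃ₗ[A] (P × A) := LinearEquiv.skewProd (.refl A P) (.refl A A) ((1 - a) • φ)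
  refine ⟨Φ.trans (ε.trans ((LinearEquiv.prodComm A A P).trans
    (ε'.trans (LinearEquiv.prodComm A P A)))), ?_⟩
  simp [ε, ε', ← ha]
  ring

/-- A map `A × P → P` that kills `(a, p)` when `r = φ (p + a • q)`, and whose kernel is generated
by `(a, p)` when moreover `r` is invertible. -/
def pushHom (a r : A) (p q : P) (φ : Dual A P) : (A × P) →ₗ[A] P :=
  let l := LinearMap.snd A A P + (LinearMap.fst A A P).smulRight q
  r • l - (r • LinearMap.fst A A P + (1 - a) • φ ∘ₗ l).smulRight (p + a • q)

/-- A section of `pushHom` up to the factor `r ^ 2`. -/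
def pullHom (a r : A) (q : P) (φ : Dual A P) : P →ₗ[A] (A × P) :=
  LinearMap.prod (-((1 - a) • φ)) (r • LinearMap.id + (1 - a) • φ.smulRight q)

theorem pushHom_apply (a r : A) (p q : P) (φ : Dual A P) (x : A) (y : P) :
    pushHom a r p q φ (x, y) =
      r • (y + x • q) - (r * x + (1 - a) * φ (y + x • q)) • (p + a • q) := by
  simp [pushHom]

theorem pullHom_apply (a r : A) (q : P) (φ : Dual A P) (y : P) :
    pullHom a r q φ y = (-((1 - a) * φ y), r • y + ((1 - a) * φ y) • q) := by
  simp [pullHom, mul_smul]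

theorem pushHom_self {a r : A} {p q : P} {φ : Dual A P} (hr : φ (p + a • q) = r) :
    pushHom a r p q φ (a, p) = 0 := by
  rw [pushHom_apply, hr, ← sub_smul]
  convert zero_smul A _
  ring

theorem pushHom_pullHom {a r r' : A} {p q q' : P} {φ φ' : Dual A P} (y : P) :
    pushHom a r p q φ (pullHom a r' q' φ' y) = (r * r') • y + (1 - a) •
      ((r * φ' y) • (q' - q + p + a • q) -
        φ (r' • y + ((1 - a) * φ' y) • (q' - q)) • (p + a • q)) := by
  have : r' • y + ((1 - a) * φ' y) • q' + (-((1 - a) * φ' y)) • q =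
    r' • y + ((1 - a) * φ' y) • (q' - q) := by module
  rw [pullHom_apply, pushHom_apply, this]
  module

theorem pushHom_pullHom_self {a r : A} {p q : P} {φ : Dual A P} (y : P) :
    pushHom a r p q φ (pullHom a r q φ y) = (r * r) • y := by
  rw [pushHom_pullHom, sub_self, smul_zero, add_zero, map_smul, smul_eq_mul]
  module

theorem pullHom_pushHom_self {a r : A} {p q : P} {φ : Dual A P} (hr : φ (p + a • q) = r)
    (x : A) (y : P) :
    ∃ c : A, pullHom a r q φ (pushHom a r p q φ (x, y)) = (r * r) • (x, y) - c • (a, p) := by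
  refine ⟨r * (r * x + (1 - a) * φ (y + x • q)), ?_⟩
  have h : φ (pushHom a r p q φ (x, y)) = r * (a * φ (y + x • q) - r * x) := by
    rw [pushHom_apply, map_sub, map_smul, map_smul, hr, smul_eq_mul, smul_eq_mul]
    ring
  rw [pullHom_apply, h, pushHom_apply]
  generalize φ (y + x • q) = c
  ext
  · simp only [Prod.smul_mk, Prod.mk_sub_mk, smul_eq_mul]
    ring
  · simp only [Prod.smul_mk, Prod.mk_sub_mk]
    module

/-- Comparison maps between the complements `Q` and `P` of unimodular elements of `A × P`. -/
theorem exists_comparison (Φ : (A × Q) ≃ₗ[A] (A × P)) {a : A} {p : P} (hΦ : Φ (1, 0) = (a, p))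
    {s t : A} {q₁ q₂ : P} (hs : s ∈ orderIdeal (p + a • q₁)) (ht : t ∈ orderIdeal (p + a • q₂)) :
    ∃ (b₁ b₂ : Q →ₗ[A] P) (c₁ c₂ : P →ₗ[A] Q) (h : Module.End A P),
      b₁ ∘ₗ c₁ = (s * s) • LinearMap.id ∧ c₁ ∘ₗ b₁ = (s * s) • LinearMap.id ∧
      b₂ ∘ₗ c₂ = (t * t) • LinearMap.id ∧ c₂ ∘ₗ b₂ = (t * t) • LinearMap.id ∧
      b₁ ∘ₗ c₂ = (s * t) • LinearMap.id + (1 - a) • h := by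
  obtain ⟨φ₁, h₁⟩ := mem_orderIdeal.1 hs
  obtain ⟨φ₂, h₂⟩ := mem_orderIdeal.1 ht
  set j : Q →ₗ[A] (A × P) := Φ.toLinearMap ∘ₗ LinearMap.inr A A Q with hj
  set π : (A × P) →ₗ[A] Q := LinearMap.snd A A Q ∘ₗ Φ.symm.toLinearMap with hπ
  have hjπ : ∀ z, j (π z) = z - (Φ.symm z).1 • (a, p) := by
    intro z
    rw [← hΦ, ← map_smul, eq_sub_iff_add_eq]
    change Φ (0, (Φ.symm z).2) + _ = z
    rw [← map_add, ← LinearEquiv.eq_symm_apply]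
    ext <;> simp
  have hπj : ∀ y, π (j y) = y := by intro y; simp [hj, hπ]
  have hπv : π (a, p) = 0 := by rw [← hΦ]; simp [hπ]
  have key : ∀ (r : A) (q : P) (φ : Dual A P), φ (p + a • q) = r → ∀ z,
      pushHom a r p q φ (j (π z)) = pushHom a r p q φ z := by
    intro r q φ hr z
    rw [hjπ, map_sub, map_smul, pushHom_self hr, smul_zero, sub_zero]
  have hbc : ∀ (r : A) (q : P) (φ : Dual A P), φ (p + a • q) = r →
      (pushHom a r p q φ ∘ₗ j) ∘ₗ (π ∘ₗ pullHom a r q φ) = (r * r) • LinearMap.id := by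
    intro r q φ hr
    ext y
    exact (key r q φ hr _).trans (pushHom_pullHom_self y)
  have hcb : ∀ (r : A) (q : P) (φ : Dual A P), φ (p + a • q) = r →
      (π ∘ₗ pullHom a r q φ) ∘ₗ (pushHom a r p q φ ∘ₗ j) = (r * r) • LinearMap.id := by
    intro r q φ hr
    ext y
    obtain ⟨c, hc⟩ := pullHom_pushHom_self hr (j y).1 (j y).2
    change π (pullHom a r q φ (pushHom a r p q φ ((j y).1, (j y).2))) = (r * r) • y
    rw [hc, map_sub, map_smul, map_smul, hπv, smul_zero, sub_zero]
    exact congrArg _ (hπj y)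
  refine ⟨pushHom a s p q₁ φ₁ ∘ₗ j, pushHom a t p q₂ φ₂ ∘ₗ j, π ∘ₗ pullHom a s q₁ φ₁,
    π ∘ₗ pullHom a t q₂ φ₂,
    s • φ₂.smulRight (q₂ - q₁ + p + a • q₁) -
      (φ₁ ∘ₗ (t • LinearMap.id + (1 - a) • φ₂.smulRight (q₂ - q₁))).smulRight (p + a • q₁),
    hbc _ _ _ h₁, hcb _ _ _ h₁, hbc _ _ _ h₂, hcb _ _ _ h₂, ?_⟩
  ext y
  refine (key _ _ _ h₁ _).trans ((pushHom_pullHom y).trans ?_)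
  simp only [LinearMap.add_apply, LinearMap.smul_apply, LinearMap.sub_apply, LinearMap.id_apply,
    LinearMap.smulRight_apply, LinearMap.comp_apply, mul_smul]

end Complement

/-- Patching of two comparison maps `Q → P`, one over each of two coprime localizations. -/
theorem exists_surjective_of_comparison {A K P Q m : Type*} [CommRing A] [CommRing K]
    [AddCommGroup P] [Module A P] [Module.Finite A P] [AddCommGroup Q] [Module A Q] [Fintype m]
    [DecidableEq m] {ι : P →ₗ[A] m → A} {ρ : (m → A) →ₗ[A] P} (hρι : ∀ y, ρ (ι y) = y)
    (g : A →+* K[X]) (hg : ∀ x, g x = 0 → IsNilpotent x) {s t : A} (hcop : IsCoprime s t)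
    (hu : IsUnit (g (s * t))) (hsurj : ∀ b : K[X], ∃ (k : ℕ) (a : A), g a = g (s * t) ^ k * b)
    {U V : Matrix m m K[X]} {E : Matrix m m K} (hUV : U * V = 1) (hVU : V * U = 1)
    (hE : U * g.mapMatrix (endMatrix ι ρ 1) * V = E.map C)
    {b₁ b₂ : Q →ₗ[A] P} {c₁ c₂ : P →ₗ[A] Q} {h : Module.End A P} {z : A}
    (hz : (g z).coeff 0 = 0)
    (h₁ : b₁ ∘ₗ c₁ = (s * s) • LinearMap.id) (h₁' : c₁ ∘ₗ b₁ = (s * s) • LinearMap.id)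
    (h₂ : b₂ ∘ₗ c₂ = (t * t) • LinearMap.id) (h₂' : c₂ ∘ₗ b₂ = (t * t) • LinearMap.id)
    (h₁₂ : b₁ ∘ₗ c₂ = (s * t) • LinearMap.id + z • h) :
    ∃ γ : Q →ₗ[A] P, Function.Surjective γ := by
  set Ψ : Module.End A P → Matrix m m K[X] := fun f => g.mapMatrix (endMatrix ι ρ f) with hΨ
  have Ψmul : ∀ f f', Ψ (f * f') = Ψ f * Ψ f' := fun f f' => by
    rw [hΨ]; simp only [endMatrix_mul hρι, map_mul]
  have Ψadd : ∀ f f', Ψ (f + f') = Ψ f + Ψ f' := fun f f' => by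
    rw [hΨ]; simp only [map_add]
  have Ψsmul : ∀ (c : A) f, Ψ (c • f) = g c • Ψ f := fun c f => by
    ext1 i j
    simp [hΨ]
  set e := Ψ 1 with he
  have heΨ : ∀ f, e * Ψ f = Ψ f := fun f => by rw [he, ← Ψmul, one_mul]
  have hΨe : ∀ f, Ψ f * e = Ψ f := fun f => by rw [he, ← Ψmul, mul_one]
  have lift : ∀ (c : A) (M : Matrix m m K[X]), e * M = M → M * e = M →
      g c • M ∈ g.mapMatrix.range → ∃ f, Ψ f = g c • M := by
    rintro c M heM hMe ⟨N, hN⟩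
    obtain ⟨f, hf⟩ := exists_endMatrix_eq (ι := ι) (ρ := ρ)
      (M := endMatrix ι ρ 1 * N * endMatrix ι ρ 1) (by
        have h1 : endMatrix ι ρ 1 * endMatrix ι ρ 1 = endMatrix ι ρ 1 := by
          rw [← endMatrix_mul hρι, one_mul]
        simp only [mul_assoc, h1]
        rw [← mul_assoc, h1])
    refine ⟨f, ?_⟩
    rw [hΨ]
    simp only [hf, map_mul, hN]
    change e * (g c • M) * e = _
    rw [mul_smul_comm, smul_mul_assoc, heM, hMe]
  obtain ⟨u, hu'⟩ := hu.exists_left_inv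
  have hc : ∀ f f' : Module.End A P, f * f' = ((s * t) * (s * t)) • 1 →
      (u • Ψ f) * (u • Ψ f') = e := by
    intro f f' hff
    rw [smul_mul_smul_comm, ← Ψmul, hff, Ψsmul, smul_smul, map_mul g (s * t)]
    rw [show u * u * (g (s * t) * g (s * t)) = (u * g (s * t)) * (u * g (s * t)) by ring, hu',
      one_mul, one_smul]
  have mid : ∀ {b b' : Q →ₗ[A] P} {c c' : P →ₗ[A] Q} {x y : A}, c ∘ₗ b' = x • LinearMap.id →
      b ∘ₗ c' = y • LinearMap.id → (b ∘ₗ c) * (b' ∘ₗ c') = (x * y) • (1 : Module.End A P) := by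
    intro b b' c c' x y hcb hbc
    ext p
    have e1 := LinearMap.congr_fun hcb (c' p)
    have e2 := LinearMap.congr_fun hbc p
    simp only [LinearMap.comp_apply, LinearMap.smul_apply, LinearMap.id_apply] at e1 e2
    change b (c (b' (c' p))) = (x * y) • p
    rw [e1, map_smul, e2, smul_smul]
  obtain ⟨n, F, F', G, G', ⟨hF, hF', hG, hG'⟩, ⟨heF, hFe⟩, ⟨heF', hF'e⟩, ⟨heG, hGe⟩, ⟨heG', hG'e⟩,
    hFF', hGG', hFG', hGF'⟩ := exists_quillen_splitting (m := m) g s t hcop hu hsurj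
      (e := e) (θ := u • Ψ (b₁ ∘ₗ c₂)) (θ' := u • Ψ (b₂ ∘ₗ c₁)) hUV hVU hE ⟨_, rfl⟩
      (by rw [mul_smul_comm, heΨ]) (by rw [smul_mul_assoc, hΨe])
      (by rw [mul_smul_comm, heΨ]) (by rw [smul_mul_assoc, hΨe])
      (hc _ _ (by rw [mid h₂' h₁]; congr 1; ring)) (hc _ _ (by rw [mid h₁' h₂]; congr 1; ring))
      (by
        have h3 : Ψ (b₁ ∘ₗ c₂) = g (s * t) • e + g z • Ψ h := by
          rw [h₁₂, Ψadd, Ψsmul, Ψsmul]; rfl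
        rw [h3, smul_add, smul_smul, hu', one_smul]
        have h4 : ∀ f : K[X], constantCoeff (u * g z * f) = 0 := fun f => by simp [hz]
        ext i j
        simp only [Matrix.map_apply, Matrix.add_apply, Matrix.smul_apply, smul_smul, smul_eq_mul,
          map_add, h4, add_zero])
  rw [← map_pow] at hF hF' hG hG'
  obtain ⟨f, hf⟩ := lift _ _ heF hFe hF
  obtain ⟨f', hf'⟩ := lift _ _ heF' hF'e hF'
  obtain ⟨k, hk⟩ := lift _ _ heG hGe hG
  obtain ⟨k', hk'⟩ := lift _ _ heG' hG'e hG'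
  obtain ⟨x, y, hxy⟩ := hcop.pow (m := n + 1) (n := n + 1)
  set γ : Q →ₗ[A] P := x • (f ∘ₗ b₁) + y • (k ∘ₗ b₂)
  set γ' : P →ₗ[A] Q := x • (c₁ ∘ₗ f') + y • (c₂ ∘ₗ k')
  have hγ : γ ∘ₗ γ' = (x * x) • (f * (b₁ ∘ₗ c₁) * f') + (x * y) • (f * (b₁ ∘ₗ c₂) * k') +
      ((x * y) • (k * (b₂ ∘ₗ c₁) * f') + (y * y) • (k * (b₂ ∘ₗ c₂) * k')) := by
    ext p
    simp only [γ, γ', LinearMap.comp_apply, LinearMap.add_apply, LinearMap.smul_apply, map_add,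
      map_smul, Module.End.mul_apply]
    module
  have hΨb : ∀ f : Module.End A P, Ψ f = g (s * t) • u • Ψ f := fun f => by
    rw [smul_smul, mul_comm, hu', one_smul]
  have hsq : ∀ a : A, Ψ ((a * a) • LinearMap.id) = g (a * a) • e := fun a => Ψsmul _ _
  have hΨγ : Ψ (γ ∘ₗ γ') = e := by
    rw [hγ]
    simp only [Ψadd, Ψsmul, Ψmul, hf, hf', hk, hk']
    rw [hΨb (b₁ ∘ₗ c₂), hΨb (b₂ ∘ₗ c₁), h₁, h₂, hsq, hsq]
    generalize u • Ψ (b₁ ∘ₗ c₂) = T at hFG'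
    generalize u • Ψ (b₂ ∘ₗ c₁) = T' at hGF'
    have hmul : ∀ (a b c : K[X]) (L M N : Matrix m m K[X]),
        a • L * b • M * c • N = (a * b * c) • (L * M * N) := fun a b c L M N => by
      rw [smul_mul_smul_comm, smul_mul_smul_comm]
    simp only [hmul, hFG', hGF', hFe, hGe, hFF', hGG', smul_smul, ← map_mul, ← add_smul, ← map_add]
    convert one_smul K[X] e
    rw [← map_one g, ← one_pow 2, ← hxy]
    congr 1
    ring
  refine ⟨γ, Function.Surjective.of_comp (g := γ') ?_⟩
  exact surjective_of_endMatrix_eq hρι g hg hΨγ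

theorem exists_localization_conj.{u} {R : Type u} [CommRing R] [IsNoetherianRing R] {m : Type*}
    [Fintype m] [DecidableEq m] (e : Matrix m m R[X]) (he : e * e = e) :
    ∃ σ : R, (∀ q ∈ minimalPrimes R, σ ∉ q) ∧ ∀ z : R, σ ∣ z → (∀ q ∈ minimalPrimes R, z ∉ q) →
      ∃ (K : Type u) (_ : CommRing K) (k : R →+* K) (U V : Matrix m m K[X]) (E : Matrix m m K),
        IsUnit (k z) ∧ (∀ b, ∃ (n : ℕ) (r : R), k r = k z ^ n * b) ∧
        (∀ r, k r = 0 → IsNilpotent r) ∧ U * V = 1 ∧ V * U = 1 ∧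
        U * (mapRingHom k).mapMatrix e * V = E.map C := by
  set π := Ideal.Quotient.mk (nilradical R) with hπ
  have hred : IsReduced (R ⧸ nilradical R) :=
    (Ideal.isRadical_iff_quotient_reduced _).1 (Ideal.radical_isRadical _)
  obtain ⟨σ', U, V, E, hσ', hUV, hVU, hE⟩ := exists_conj_constant ((mapRingHom π).mapMatrix e)
    (by rw [← map_mul, he])
  obtain ⟨σ, rfl⟩ := Ideal.Quotient.mk_surjective σ'
  have hmin : ∀ z : R, (∀ q ∈ minimalPrimes R, z ∉ q) ↔
      ∀ q ∈ minimalPrimes (R ⧸ nilradical R), π z ∉ q := by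
    have h : minimalPrimes R = Ideal.comap π '' minimalPrimes (R ⧸ nilradical R) := by
      rw [hπ, ← Ideal.minimalPrimes_eq_comap]
      exact (Ideal.radical_minimalPrimes (I := (⊥ : Ideal R))).symm
    intro z
    rw [h, Set.forall_mem_image]
    rfl
  refine ⟨σ, (hmin σ).2 hσ', fun z hσz hz => ?_⟩
  set K := Localization.Away (π z)
  set l := algebraMap (R ⧸ nilradical R) K
  have hz' : π z ∈ nonZeroDivisors (R ⧸ nilradical R) := by
    refine mem_nonZeroDivisors_iff_right.2 fun y hy => ?_
    rw [← Submodule.mem_bot (R ⧸ nilradical R), ← (Ideal.isRadical_bot).radical,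
      ← Ideal.sInf_minimalPrimes, Submodule.mem_sInf]
    intro q hq
    have := hq.1.1
    exact (this.mem_or_mem (hy ▸ q.zero_mem)).resolve_right ((hmin z).1 hz q hq)
  have hinj : Function.Injective l := IsLocalization.injective K (Submonoid.powers_le.2 hz')
  have hu : IsUnit (l (π z)) := IsLocalization.Away.algebraMap_isUnit _
  obtain ⟨w, hw⟩ := (isUnit_of_dvd_unit (map_dvd (l.comp π) hσz) hu).exists_left_inv
  set L : Matrix m m (R ⧸ nilradical R)[X] →+* Matrix m m K[X] := (mapRingHom l).mapMatrix with hL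
  have hLsmul : ∀ (r : R ⧸ nilradical R) (M : Matrix m m (R ⧸ nilradical R)[X]),
      L (r • M) = l r • L M := fun r M => by
    ext1 i j
    simp [hL, smul_eq_C_mul]
  have hcan : ∀ X Y : Matrix m m (R ⧸ nilradical R)[X], X * Y = π σ ^ 2 • 1 →
      (w • L X) * (w • L Y) = 1 := by
    intro X Y h
    rw [smul_mul_smul_comm, ← map_mul, h, hLsmul, smul_smul, map_one, map_pow]
    convert one_smul K _
    linear_combination (w * l (π σ) + 1) * hw
  refine ⟨K, inferInstance, l.comp π, w • L U, w • L V, w • E.map l, hu, fun b => ?_,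
    fun r hr => ?_, hcan _ _ hUV, hcan _ _ hVU, ?_⟩
  · obtain ⟨n, a, ha⟩ := IsLocalization.Away.surj (π z) b
    obtain ⟨r, rfl⟩ := Ideal.Quotient.mk_surjective a
    exact ⟨n, r, by rw [mul_comm]; exact ha.symm⟩
  · exact Ideal.Quotient.eq_zero_iff_mem.1 (hinj (hr.trans (map_zero l).symm))
  · have h1 : (mapRingHom (l.comp π)).mapMatrix e = L ((mapRingHom π).mapMatrix e) := by
      ext1 i j
      simp [hL, Polynomial.map_map]
    have h2 : L (E.map C) = (E.map l).map C := by
      ext1 i j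
      simp [hL]
    rw [h1, smul_mul_assoc, ← map_mul, smul_mul_smul_comm, ← map_mul, hE, hLsmul, h2, smul_smul]
    ext1 i j
    simp only [Matrix.smul_apply, Matrix.map_apply, smul_eq_C_mul, smul_eq_mul, C_mul]
    have hw' : C w * C (l (π σ)) = 1 := by rw [← C_mul]; exact (congrArg C hw).trans C_1
    linear_combination C w * C (l (E i j)) * hw'

section Geometric

variable {R K : Type*} [CommRing R] [CommRing K] {A : Subalgebra R R[X]} {s₀ : R}

theorem exists_map_eq_pow_mul (hA : ∀ f : R[X], ∃ k : ℕ, (C s₀) ^ k * f ∈ A) {z : R} (hz : s₀ ∣ z)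
    (k : R →+* K) (hk : ∀ b, ∃ (n : ℕ) (r : R), k r = k z ^ n * b) (b : K[X]) :
    ∃ (n : ℕ) (x : A), (mapRingHom k).comp A.val.toRingHom x =
      (mapRingHom k).comp A.val.toRingHom (algebraMap R A z) ^ n * b := by
  obtain ⟨n, hn⟩ := exists_pow_mul_mem_range_mapRingHom k z hk b
  obtain ⟨f, hf⟩ := hn n le_rfl
  obtain ⟨l, hl⟩ := hA f
  obtain ⟨y, rfl⟩ := hz
  have hy : C (s₀ * y) ^ l * f ∈ A := by
    rw [C_mul, mul_pow, mul_comm (C s₀ ^ l), mul_assoc]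
    exact A.mul_mem (A.pow_mem (A.algebraMap_mem y) l) hl
  refine ⟨l + n, ⟨_, hy⟩, ?_⟩
  change mapRingHom k (C (s₀ * y) ^ l * f) = mapRingHom k (C (s₀ * y)) ^ (l + n) * b
  rw [map_mul, hf, map_pow, pow_add, mul_assoc, coe_mapRingHom, map_C]

theorem isNilpotent_of_map_eq_zero (k : R →+* K) (hk : ∀ r, k r = 0 → IsNilpotent r) (x : A)
    (hx : (mapRingHom k).comp A.val.toRingHom x = 0) : IsNilpotent x := by
  have h : IsNilpotent (x : R[X]) := Polynomial.isNilpotent_iff.2 fun i => hk _ (by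
    rw [← coeff_map]
    exact congrArg (fun f => coeff f i) hx)
  exact (IsNilpotent.map_iff (f := A.val.toRingHom) Subtype.val_injective).1 h

end Geometric

theorem nonempty_linearEquiv_of_prod_equiv {R : Type*} [CommRing R] [IsNoetherianRing R] {d : ℕ}
    (hd : 1 ≤ d) (hdim : ringKrullDim R = (d : ℕ)) {A : Subalgebra R R[X]} [IsNoetherianRing A]
    (hAdim : ringKrullDim A = (d + 1 : ℕ)) {s₀ : R} (hs₀ : s₀ ∈ nonZeroDivisors R)
    (hA : ∀ f : R[X], ∃ k : ℕ, (C s₀) ^ k * f ∈ A) {P Q : Type*} [AddCommGroup P] [Module A P]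
    [Module.Finite A P] [Module.Projective A P] [AddCommGroup Q] [Module A Q] [Module.Finite A Q]
    (hrank : ∀ p : PrimeSpectrum A, d + 1 ≤ rankAtStalk P p) (Φ₀ : (A × Q) ≃ₗ[A] (A × P)) :
    Nonempty (Q ≃ₗ[A] P) := by
  obtain ⟨μ₀, φ₀, h₀⟩ := exists_smul_add_apply_eq_one Φ₀
  obtain ⟨q₀, ψ₀, hψ₀⟩ := exists_dual_apply_sub_one_coeff_zero hdim hrank _ _ _ _ h₀
  obtain ⟨Φ, hΦ⟩ := exists_equiv_fst_eq Φ₀ q₀ ψ₀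
  obtain ⟨μ, φ, hμ⟩ := exists_smul_add_apply_eq_one Φ
  have hz : ((1 - (Φ (1, 0)).1 : A) : R[X]).coeff 0 = 0 := by
    rw [hΦ, MulMemClass.coe_mul, mul_coeff_zero]
    have : ((1 - ψ₀ ((Φ₀ (1, 0)).2 + (Φ₀ (1, 0)).1 • q₀) : A) : R[X]).coeff 0 = 0 := by
      rw [AddSubgroupClass.coe_sub, coeff_sub, hψ₀]
      simp
    rw [this, mul_zero]
  obtain ⟨n, ρ, hρ⟩ := Module.Finite.exists_fin' A P
  obtain ⟨ι, hι⟩ := Module.projective_lifting_property ρ LinearMap.id hρ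
  have hρι : ∀ y, ρ (ι y) = y := LinearMap.congr_fun hι
  obtain ⟨σ, hσ, hloc⟩ := exists_localization_conj
    (A.val.toRingHom.mapMatrix (endMatrix ι ρ 1))
    (by rw [← map_mul, ← endMatrix_mul hρι, one_mul])
  obtain ⟨s, t, hcop, hs₀s, hσs, hst, ⟨q₁, hq₁⟩, ⟨q₂, hq₂⟩⟩ :=
    exists_isCoprime_mem_orderIdeal hd hdim hAdim hs₀ hA hrank σ hσ _ _ _ _ hμ
  obtain ⟨K, _, k, U, V, E, hk, hksurj, hkker, hUV, hVU, hE⟩ :=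
    hloc (s * t) (hσs.mul_right t) hst
  obtain ⟨b₁, b₂, c₁, c₂, h, h₁, h₁', h₂, h₂', h₁₂⟩ := exists_comparison Φ rfl hq₁ hq₂
  obtain ⟨γ, hγ⟩ := exists_surjective_of_comparison hρι ((mapRingHom k).comp A.val.toRingHom)
    (isNilpotent_of_map_eq_zero k hkker) (hcop.map (algebraMap R A))
    (by
      rw [← map_mul]
      convert hk.map C
      exact map_C k)
    (by
      rw [← map_mul]
      exact exists_map_eq_pow_mul hA (hs₀s.mul_right t) k hksurj)
    hUV hVU hE
    (by
      change (mapRingHom k _).coeff 0 = 0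
      rw [coe_mapRingHom, coeff_map]
      exact (congrArg k hz).trans (map_zero k))
    h₁ h₁' h₂ h₂' h₁₂
  exact ⟨LinearEquiv.ofBijective γ (bijective_of_surjective_of_prod_equiv Φ γ hγ)⟩

end

theorem stmt_1 {R : Type*} [CommRing R] [IsNoetherianRing R] (d : ℕ) (hd : 1 ≤ d)
    (hdim : ringKrullDim R = (d : ℕ))
    (A : Subalgebra R (Polynomial R)) (hA : IsGeometricSubring A d)
    (P : Type v) [AddCommGroup P] [Module A P] [Module.Finite A P] [Module.Projective A P]
    (hrank : ∀ (p : Ideal A) (hp : p.IsPrime), d + 1 ≤ rankAt P p hp) :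
    ∀ (Q : Type v) [AddCommGroup Q] [Module A Q] [Module.Finite A Q],
      Nonempty ((A × Q) ≃ₗ[A] (A × P)) → Nonempty (Q ≃ₗ[A] P) := by
  intro Q _ _ _ ⟨Φ⟩
  obtain ⟨hnoeth, ⟨s₀, hs₀, hs₀A⟩, hAdim⟩ := hA
  exact nonempty_linearEquiv_of_prod_equiv hd hdim hAdim hs₀ hs₀A
    (fun p => hrank p.asIdeal p.isPrime) Φ
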